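/- arXiv:0805.4367 — 2 statements merged into one kernel-verified Lean document; each statement's English description precedes it below -/
import Mathlib

section
/- Consider the Volterra predator–prey system (E_0): x' = x(a − b y), y' = y(−c + d x) with constants a, b, c, d > 0, and its harvested version (E_μ): x' = x(a_μ − b y), y' = y(−c_μ + d x) where a_μ = a − μ, c_μ = c + μ for a parameter 0 < μ < a. Let ℓ_1, ℓ_2, h_1, h_2 be real numbers with E_0(c/d, a/b) < ℓ_1 < ℓ_2 and E_μ(c_μ/d, a_μ/b) < h_1 < h_2, where E_0(x,y) = d x − c log x + b y − a log y and E_μ(x,y) = d x − c_μ log x + b y − a_μ log y on the open quadrant (0,∞)². Set A_P = {z ∈ (0,∞)² : ℓ_1 ≤ E_0(z) ≤ ℓ_2}, A_Q = {z ∈ (0,∞)² : h_1 ≤ E_μ(z) ≤ h_2}, and let r = {(x,y) ∈ (0,∞)² : d x + b y = a + c} be the line through P = (c/d, a/b) and Q = (c_μ/d, a_μ/b). Assume the annuli A_P and A_Q are linked together, namely: for i = 1,2 the sets {z ∈ (0,∞)² : E_0(z) = ℓ_i} ∩ r and {z ∈ (0,∞)² : E_μ(z) = h_i} ∩ r each consist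 of exactly two points, P_{i,−}, P_{i,+} and Q_{i,−}, Q_{i,+} respectively, whose first coordinates satisfy x(P_{2,−}) < x(P_{1,−}) ≤ x(Q_{2,−}) < x(Q_{1,−}) ≤ x(P_{1,+}) < x(P_{2,+}) ≤ x(Q_{1,+}) < x(Q_{2,+}). Define R_1 = A_P ∩ A_Q ∩ {(x,y) : d x + b y ≤ a + c} and R_2 = A_P ∩ A_Q ∩ {(x,y) : d x + b y ≥ a + c}. Then for every integer m ≥ 2 there exist positive constants α and β such that: for all r_0 > α and r_μ > β, if φ_0, φ_μ : (0,∞)² → (0,∞)² are maps such that for every z ∈ (0,∞)² there is a C¹ curve ζ = (x,y) : [0, r_0] → (0,∞)² with ζ(0) = z, x'(t) = x(t)(a − b y(t)) and y'(t) = y(t)(−c + d x(t)) for all t ∈ [0, r_0], and ζ(r_0) = φ_0(z), and likewise for every z there is a C¹ curve on [0, r_μ] from z solving x' = x(a_μ − b y), y' = y(−c_μ + d x) and ending at φ_μ(z), then the composite map φ = φ_μ ∘ φ_0 induces chaotic dynamics on m symbols both in R_1 and in R_2. -/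
/-- `ψ` induces chaotic dynamics on `m` symbols in the set `D`: there are `m` pairwise
disjoint nonempty compact subsets `K j ⊆ D` such that every two-sided sequence of
symbols is realized by a two-sided orbit of `ψ` with the prescribed itinerary, and
`k`-periodic symbol sequences are realized by `k`-periodic orbits. -/
def InducesChaoticDynamics {Z : Type*} [MetricSpace Z] (ψ : Z → Z) (D : Set Z)
    (m : ℕ) : Prop :=
  ∃ K : Fin m → Set Z,
    (∀ j, (K j).Nonempty ∧ IsCompact (K j) ∧ K j ⊆ D) ∧
    (Pairwise fun i j => Disjoint (K i) (K j)) ∧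
    (∀ s : ℤ → Fin m, ∃ w : ℤ → Z,
      (∀ i, w i ∈ K (s i)) ∧ ∀ i, w (i + 1) = ψ (w i)) ∧
    ∀ (s : ℤ → Fin m) (k : ℕ), 1 ≤ k → (∀ i, s (i + (k : ℤ)) = s i) →
      ∃ w : ℤ → Z, (∀ i, w i ∈ K (s i)) ∧ (∀ i, w (i + 1) = ψ (w i)) ∧
        ∀ i, w (i + (k : ℤ)) = w i

open Polynomial in
theorem vh_det_interp {V : Type*} [NormedAddCommGroup V] [NormedSpace ℝ V] [FiniteDimensional ℝ V]
    (t : ℕ → ℝ) (ht : Function.Injective t) (A : V →L[ℝ] V) :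
    (ContinuousLinearMap.id ℝ V + A).det = ∑ j ∈ Finset.range (Module.finrank ℝ V + 1),
      (Lagrange.basis (Finset.range (Module.finrank ℝ V + 1)) t j).eval 1 *
        (ContinuousLinearMap.id ℝ V + t j • A).det := by
  classical
  set n := Module.finrank ℝ V with hn
  let b := Module.finBasis ℝ V
  let M : Matrix (Fin n) (Fin n) ℝ := LinearMap.toMatrix b b (A : V →ₗ[ℝ] V)
  have key : ∀ s : ℝ, (ContinuousLinearMap.id ℝ V + s • A).det =
      (Matrix.det ((X : ℝ[X]) • M.map C + (1 : Matrix (Fin n) (Fin n) ℝ).map C)).eval s := by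
    intro s
    have hid : LinearMap.toMatrix b b ((ContinuousLinearMap.id ℝ V : V →L[ℝ] V) : V →ₗ[ℝ] V) = 1 :=
      LinearMap.toMatrix_id b
    rw [← Polynomial.coe_evalRingHom, RingHom.map_det]
    rw [ContinuousLinearMap.det, ← LinearMap.det_toMatrix b]
    congr 1
    ext i j
    simp only [ContinuousLinearMap.toLinearMap_add, map_add, ContinuousLinearMap.toLinearMap_smul,
      map_smul, hid, Matrix.add_apply,
      Matrix.smul_apply, RingHom.mapMatrix_apply, Matrix.map_apply, Polynomial.coe_evalRingHom,
      Polynomial.eval_C, smul_eq_mul, Polynomial.eval_mul, Polynomial.eval_X, M]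
    have h11 : ((1 : Matrix (Fin n) (Fin n) ℝ) i j) =
      (1 : Matrix (Fin (Module.finrank ℝ V)) (Fin (Module.finrank ℝ V)) ℝ) i j := rfl
    ring
  have hdeg : (Matrix.det ((X : ℝ[X]) • M.map C + (1 : Matrix (Fin n) (Fin n) ℝ).map C)).degree <
      (Finset.range (n+1)).card := by
    have := Polynomial.natDegree_det_X_add_C_le M 1
    refine lt_of_le_of_lt Polynomial.degree_le_natDegree ?_
    simp only [Fintype.card_fin, Finset.card_range] at *
    exact_mod_cast Nat.lt_succ_of_le this
  have h1 := Lagrange.eq_interpolate (ht.injOn (s := (Finset.range (n+1) : Set ℕ))) hdeg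
  have h2 := key 1
  rw [one_smul] at h2
  rw [h2, h1, Lagrange.interpolate_apply, Polynomial.eval_finsetSum]
  refine Finset.sum_congr rfl fun j _ => ?_
  rw [key, Polynomial.eval_mul, Polynomial.eval_C, mul_comm]

open MeasureTheory Metric in
theorem vh_no_retraction {V : Type*} [NormedAddCommGroup V] [InnerProductSpace ℝ V]
    [FiniteDimensional ℝ V] (R : ℝ) (hR : 0 < R) (f : V → V) (hf : ContDiff ℝ 1 f)
    (h1 : ∀ x, ‖f x‖ = R) (h2 : ∀ x, ‖x‖ = R → f x = x) : False := by
  classical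
  borelize V
  let μ : Measure V := volume
  let D : V → V →L[ℝ] V := fun x => fderiv ℝ f x - ContinuousLinearMap.id ℝ V
  have hDc : Continuous D := (hf.continuous_fderiv one_ne_zero).sub continuous_const
  obtain ⟨C, hC⟩ := (isCompact_closedBall (0 : V) R).exists_bound_of_continuousOn hDc.continuousOn
  have hC0 : 0 ≤ C := (norm_nonneg _).trans (hC 0 (by simp [hR.le]))
  have hfd : ∀ x, HasFDerivAt f (fderiv ℝ f x) x := fun x =>
    (hf.differentiable one_ne_zero x).hasFDerivAt
  have hfd' : ∀ x, HasFDerivAt (fun x => f x - x) (D x) x := fun x =>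
    (hfd x).sub (hasFDerivAt_id x)
  let g : V → V := fun x => if ‖x‖ ≤ R then f x - x else 0
  have hgin : ∀ x, ‖x‖ ≤ R → g x = f x - x := fun x hx => by simp [g, hx]
  have hgout : ∀ x, R ≤ ‖x‖ → g x = 0 := fun x hx => by
    by_cases h : ‖x‖ ≤ R
    · rw [hgin x h, h2 x (le_antisymm h hx), sub_self]
    · simp [g, h]
  have hl1 : ∀ x y, ‖x‖ ≤ R → ‖y‖ ≤ R → ‖g x - g y‖ ≤ C * ‖x - y‖ := by
    intro x y hx hy
    rw [hgin x hx, hgin y hy]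
    exact (convex_closedBall (0:V) R).norm_image_sub_le_of_norm_hasFDerivWithin_le
      (fun z _ => (hfd' z).hasFDerivWithinAt) hC (by simpa using hy) (by simpa using hx)
  have hl2 : ∀ x y, ‖x‖ ≤ R → R ≤ ‖y‖ → ‖g x - g y‖ ≤ C * ‖x - y‖ := by
    intro x y hx hy
    have hcont : ContinuousOn (fun s : ℝ => ‖x + s • (y - x)‖) (Set.Icc 0 1) := by fun_prop
    obtain ⟨s, hs, hsR⟩ := intermediate_value_Icc zero_le_one hcont
      (show R ∈ Set.Icc _ _ by simpa using ⟨hx, hy⟩)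
    simp only at hsR
    have h3 := hl1 x (x + s • (y - x)) hx hsR.le
    rw [hgout _ hsR.ge] at h3
    rw [hgout y hy]
    refine h3.trans ?_
    gcongr
    rw [sub_add_cancel_left, norm_neg, norm_smul, norm_sub_rev x y, Real.norm_of_nonneg hs.1]
    exact mul_le_of_le_one_left (norm_nonneg _) hs.2
  have hlip : ∀ x y, ‖g x - g y‖ ≤ C * ‖x - y‖ := by
    intro x y
    rcases le_total ‖x‖ R with hx | hx <;> rcases le_total ‖y‖ R with hy | hy
    · exact hl1 x y hx hy
    · exact hl2 x y hx hy
    · rw [norm_sub_rev, norm_sub_rev x]; exact hl2 y x hy hx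
    · rw [hgout x hx, hgout y hy, sub_self, norm_zero]; positivity
  have hdetc : ContinuousAt (fun A : V →L[ℝ] V => (ContinuousLinearMap.id ℝ V + A).det) 0 :=
    (ContinuousLinearMap.continuous_det.comp (continuous_const.add continuous_id)).continuousAt
  have hev := hdetc.eventually (lt_mem_nhds (a := 0)
    (by simp [ContinuousLinearMap.det]))
  obtain ⟨δ, hδ, hball⟩ := Metric.eventually_nhds_iff.1 hev
  obtain ⟨ε, hε, hε1, hε2⟩ : ∃ ε : ℝ, 0 < ε ∧ ε * C < 1 ∧ ε * C < δ := by
    refine ⟨min 1 δ / (2 * (C + 1)), by positivity, ?_, ?_⟩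
    · rw [div_mul_eq_mul_div, div_lt_iff₀ (by positivity)]
      nlinarith [min_le_left 1 δ, lt_min one_pos hδ]
    · rw [div_mul_eq_mul_div, div_lt_iff₀ (by positivity)]
      nlinarith [min_le_right 1 δ, lt_min one_pos hδ]
  let U : Set V := ball 0 R
  have hvol : ∀ s : ℝ, 0 < s → s ≤ ε →
      ∫ x in U, (ContinuousLinearMap.id ℝ V + s • D x).det ∂μ = μ.real U := by
    intro s hs hse
    let F : V → V := fun x => x + s • g x
    have hsC : s * C < 1 := lt_of_le_of_lt (by gcongr) hε1
    have happ : ApproximatesLinearOn F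
        ((ContinuousLinearEquiv.refl ℝ V : V ≃L[ℝ] V) : V →L[ℝ] V) Set.univ
        (Real.toNNReal (s * C)) := by
      intro x _ y _
      have : F x - F y - (x - y) = s • (g x - g y) := by simp only [F]; rw [smul_sub]; abel
      simp only [ContinuousLinearEquiv.coe_refl, ContinuousLinearMap.coe_id', id]
      rw [this, norm_smul, Real.norm_of_nonneg hs.le]
      have := hlip x y
      rw [Real.coe_toNNReal _ (by positivity)]
      nlinarith
    have hc : Subsingleton V ∨ (Real.toNNReal (s * C)) <
        ‖((ContinuousLinearEquiv.refl ℝ V : V ≃L[ℝ] V).symm : V →L[ℝ] V)‖₊⁻¹ := by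
      rcases subsingleton_or_nontrivial V with h | h
      · exact Or.inl h
      · right
        simp only [ContinuousLinearEquiv.refl_symm, ContinuousLinearEquiv.coe_refl]
        rw [show ‖ContinuousLinearMap.id ℝ V‖₊ = 1 by ext; simp, inv_one]
        exact Real.toNNReal_lt_one.2 hsC
    have hinj : Function.Injective F := Set.injOn_univ.1 (happ.injOn hc)
    have hsurj : Function.Surjective F := happ.surjective hc
    have hFout : ∀ x, R ≤ ‖x‖ → F x = x := fun x hx => by simp [F, hgout x hx]
    have himg : F '' U = U := by
      ext y
      constructor
      · rintro ⟨x, hx, rfl⟩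
        by_contra h
        have h' : R ≤ ‖F x‖ := by simpa [U] using h
        have := hinj (hFout _ h')
        rw [this] at h
        exact h hx
      · intro hy
        obtain ⟨x, rfl⟩ := hsurj y
        refine ⟨x, ?_, rfl⟩
        by_contra h
        have h' : R ≤ ‖x‖ := by simpa [U] using h
        rw [hFout x h'] at hy
        exact h hy
    have hFd : ∀ x ∈ U, HasFDerivWithinAt F (ContinuousLinearMap.id ℝ V + s • D x) U x := by
      intro x hx
      have h3 : HasFDerivAt (fun x => x + s • (f x - x)) (ContinuousLinearMap.id ℝ V + s • D x) x :=
        (hasFDerivAt_id x).add ((hfd' x).const_smul s)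
      refine (h3.congr_of_eventuallyEq ?_).hasFDerivWithinAt
      filter_upwards [isOpen_ball.mem_nhds hx] with y hy
      simp only [F]
      rw [hgin y (by simpa using (mem_ball_zero_iff.1 hy).le)]
    have h4 := integral_image_eq_integral_abs_det_fderiv_smul μ
      (measurableSet_ball : MeasurableSet U) hFd hinj.injOn (fun _ => (1:ℝ))
    rw [himg] at h4
    simp only [smul_eq_mul, mul_one, setIntegral_const] at h4
    rw [h4]
    refine setIntegral_congr_fun measurableSet_ball fun x hx => ?_
    refine (abs_of_pos (a := (_ : ℝ)) ?_).symm
    apply hball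
    rw [dist_zero_right, norm_smul, Real.norm_of_nonneg hs.le]
    refine lt_of_le_of_lt ?_ hε2
    have := hC x (ball_subset_closedBall hx)
    gcongr
  let t : ℕ → ℝ := fun j => ε / (j + 1)
  have ht : Function.Injective t := by
    intro i j hij
    simp only [t] at hij
    have h3 : (i:ℝ) + 1 = j + 1 := by
      field_simp at hij
      linarith
    exact_mod_cast add_right_cancel h3
  have hdet0 : ∀ x, (ContinuousLinearMap.id ℝ V + D x).det = 0 := by
    intro x
    have e : ContinuousLinearMap.id ℝ V + D x = fderiv ℝ f x := by simp [D]
    rw [e]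
    by_contra h
    have hort : ∀ v, inner ℝ (f x) (fderiv ℝ f x v) = 0 := by
      intro v
      have h3 := (hfd x).norm_sq
      have h4 : HasFDerivAt (fun x => ‖f x‖ ^ 2) (0 : V →L[ℝ] ℝ) x := by
        simp only [h1]
        exact hasFDerivAt_const _ _
      have h5 := congrArg (fun L : V →L[ℝ] ℝ => L v) (h3.unique h4)
      simpa using h5
    have hs : Function.Surjective (fderiv ℝ f x) :=
      (LinearMap.equivOfDetNeZero (fderiv ℝ f x : V →ₗ[ℝ] V) h).surjective
    obtain ⟨v, hv⟩ := hs (f x)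
    have := hort v
    rw [hv, real_inner_self_eq_norm_sq, h1] at this
    nlinarith
  have hint : ∀ s : ℝ, IntegrableOn (fun x => (ContinuousLinearMap.id ℝ V + s • D x).det) U μ := by
    intro s
    have : Continuous (fun x => (ContinuousLinearMap.id ℝ V + s • D x).det) :=
      ContinuousLinearMap.continuous_det.comp (continuous_const.add (hDc.const_smul s))
    exact (this.continuousOn.integrableOn_compact (isCompact_closedBall (0:V) R)).mono_set
      ball_subset_closedBall
  have hfin : (0:ℝ) = ∑ j ∈ Finset.range (Module.finrank ℝ V + 1),
      (Lagrange.basis (Finset.range (Module.finrank ℝ V + 1)) t j).eval 1 * μ.real U := by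
    calc (0:ℝ) = ∫ x in U, (ContinuousLinearMap.id ℝ V + D x).det ∂μ := by simp [hdet0]
      _ = ∫ x in U, (∑ j ∈ Finset.range (Module.finrank ℝ V + 1),
          (Lagrange.basis (Finset.range (Module.finrank ℝ V + 1)) t j).eval 1 *
          (ContinuousLinearMap.id ℝ V + t j • D x).det) ∂μ := by
          exact congrArg (fun F : V → ℝ => ∫ x in U, F x ∂μ) (funext fun x => vh_det_interp t ht (D x))
      _ = _ := by
          rw [integral_finsetSum _ (fun j _ => (hint (t j)).const_mul _)]
          refine Finset.sum_congr rfl fun j _ => ?_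
          rw [integral_const_mul, hvol (t j) (by positivity)]
          exact div_le_self hε.le (by linarith [(Nat.cast_nonneg j : (0:ℝ) ≤ j)])
  rw [← Finset.sum_mul, ← Polynomial.eval_finsetSum,
    Lagrange.sum_basis ht.injOn (by simp), Polynomial.eval_one, one_mul] at hfin
  have : 0 < μ.real U := by
    rw [measureReal_def]
    exact ENNReal.toReal_pos (measure_ball_pos μ 0 hR).ne' measure_ball_lt_top.ne
  linarith

theorem vh_exists_zero {V : Type*} [NormedAddCommGroup V] [InnerProductSpace ℝ V]
    [FiniteDimensional ℝ V] (M : ℝ) (G : V → V) (hG : Continuous G) (hM : ∀ x, ‖G x - x‖ ≤ M) :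
    ∃ x, G x = 0 := by
  by_contra hne
  push Not at hne
  have hM0 : 0 ≤ M := (norm_nonneg _).trans (hM 0)
  let R := M + 1
  let χ : V → ℝ := fun x => max 0 (min 1 (‖x‖ - R))
  have hχc : Continuous χ := by simp only [χ]; fun_prop
  have hχ0 : ∀ x, 0 ≤ χ x := fun x => le_max_left _ _
  have hχ1 : ∀ x, χ x ≤ 1 := fun x => max_le zero_le_one (min_le_left _ _)
  let H : V → V := fun x => G x + χ x • (x - G x)
  have hHc : Continuous H := by simp only [H]; fun_prop
  have hH0 : ∀ x, H x ≠ 0 := by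
    intro x
    rcases le_or_gt ‖x‖ R with h | h
    · have : χ x = 0 := max_eq_left ((min_le_right _ _).trans (by linarith))
      simpa [H, this] using hne x
    · intro h0
      have h3 : x = -((1 - χ x) • (G x - x)) := by
        have : x = H x - (1 - χ x) • (G x - x) := by simp only [H]; module
        rw [h0] at this
        rw [← zero_sub]; exact this
      have h4 : ‖x‖ ≤ M := by
        rw [h3, norm_neg, norm_smul, Real.norm_of_nonneg (by linarith [hχ1 x])]
        nlinarith [hM x, hχ0 x, hχ1 x, norm_nonneg (G x - x)]
      simp only [R] at h
      linarith
  have hHout : ∀ x, R + 1 ≤ ‖x‖ → H x = x := by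
    intro x hx
    have : χ x = 1 := by
      simp only [χ]
      rw [min_eq_left (by linarith), max_eq_right zero_le_one]
    simp [H, this]
  let r : V → V := fun x => ‖H x‖⁻¹ • H x
  have hrc : Continuous r := (hHc.norm.inv₀ fun x => norm_ne_zero_iff.2 (hH0 x)).smul hHc
  have hr1 : ∀ x, ‖r x‖ = 1 := fun x => by
    simp only [r]
    rw [norm_smul, norm_inv, norm_norm, inv_mul_cancel₀ (norm_ne_zero_iff.2 (hH0 x))]
  have hR0 : 0 < R := by simp only [R]; linarith
  obtain ⟨g, hg, hgd, hgS, -⟩ := hrc.exists_contDiff_approx_and_eqOn 1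
    (ε := fun _ => 1/2) continuous_const (fun _ => by norm_num)
    (S := {x | R + 2 ≤ ‖x‖}) (U := {x | R + 1 < ‖x‖})
    (isClosed_le continuous_const continuous_norm)
    ((isOpen_lt continuous_const continuous_norm).mem_nhdsSet.2 fun x hx => by
      simp only [Set.mem_ofPred_eq] at *; linarith)
    (by
      have : ContDiffOn ℝ 1 (fun x : V => ‖x‖⁻¹ • x) {x | R + 1 < ‖x‖} := by
        intro x hx
        have hx0 : x ≠ 0 := by
          rintro rfl
          simp only [Set.mem_ofPred_eq, norm_zero] at hx
          linarith
        exact (((contDiffAt_norm ℝ hx0).inv (norm_ne_zero_iff.2 hx0)).smul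
          contDiffAt_id).contDiffWithinAt
      refine this.congr fun x hx => ?_
      simp only [r]
      rw [hHout x (le_of_lt hx)])
  have hg0 : ∀ x, g x ≠ 0 := by
    intro x h0
    have := hgd x
    rw [h0, dist_zero_left, hr1] at this
    norm_num at this
  refine vh_no_retraction (R + 2) (by linarith) (fun x => (R + 2) • (‖g x‖⁻¹ • g x)) ?_ ?_ ?_
  · exact contDiff_const.smul (((hg.norm ℝ hg0).inv fun x => norm_ne_zero_iff.2 (hg0 x)).smul hg)
  · intro x
    rw [norm_smul, norm_smul, norm_inv, norm_norm, inv_mul_cancel₀ (norm_ne_zero_iff.2 (hg0 x)),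
      mul_one, Real.norm_of_nonneg (by linarith)]
  · intro x hx
    have h3 : g x = r x := hgS (show R + 2 ≤ ‖x‖ from hx.ge)
    rw [h3, hr1]
    simp only [r]
    rw [hHout x (by linarith), hx, inv_one, one_smul, smul_smul, mul_inv_cancel₀ (by linarith),
      one_smul]

/-- Poincaré–Miranda theorem. -/
theorem vh_poincare_miranda {ι : Type*} [Fintype ι] (lo hi : ι → ℝ) (hle : ∀ i, lo i ≤ hi i)
    (F : (ι → ℝ) → ι → ℝ) (hF : ContinuousOn F (Set.Icc lo hi))
    (hlo : ∀ x ∈ Set.Icc lo hi, ∀ i, x i = lo i → F x i < 0)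
    (hhi : ∀ x ∈ Set.Icc lo hi, ∀ i, x i = hi i → 0 < F x i) :
    ∃ x ∈ Set.Icc lo hi, ∀ i, F x i = 0 := by
  classical
  let π : (ι → ℝ) → (ι → ℝ) := fun x i => max (lo i) (min (hi i) (x i))
  have hπc : Continuous π := by
    refine continuous_pi fun i => ?_
    simp only [π]
    fun_prop
  have hπm : ∀ x, π x ∈ Set.Icc lo hi := fun x =>
    ⟨fun i => le_max_left _ _, fun i => max_le (hle i) (min_le_left _ _)⟩
  have hFπ : Continuous (fun x => F (π x)) := hF.comp_continuous hπc hπm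
  let G : EuclideanSpace ℝ ι → EuclideanSpace ℝ ι := fun x =>
    x + WithLp.toLp 2 (F (π (WithLp.ofLp x)) - π (WithLp.ofLp x))
  have hofc : Continuous (fun x : EuclideanSpace ℝ ι => (WithLp.ofLp x : ι → ℝ)) :=
    PiLp.continuous_ofLp 2 _
  have htoc : Continuous (fun x : ι → ℝ => (WithLp.toLp 2 x : EuclideanSpace ℝ ι)) :=
    PiLp.continuous_toLp 2 _
  have hGc : Continuous G :=
    continuous_id.add (htoc.comp ((hFπ.comp hofc).sub (hπc.comp hofc)))
  have hcomp : ContinuousOn (fun x : ι → ℝ => (WithLp.toLp 2 (F x - x) : EuclideanSpace ℝ ι))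
      (Set.Icc lo hi) := htoc.comp_continuousOn (hF.sub continuousOn_id)
  obtain ⟨M, hM⟩ := isCompact_Icc.exists_bound_of_continuousOn hcomp
  obtain ⟨x, hx⟩ := vh_exists_zero M G hGc (fun x => by
    simp only [G, add_sub_cancel_left]
    exact hM _ (hπm _))
  have hxi : ∀ i, x i + (F (π (WithLp.ofLp x)) i - π (WithLp.ofLp x) i) = 0 := by
    intro i
    have := congrArg (fun v : EuclideanSpace ℝ ι => v i) hx
    simpa [G] using this
  have hfix : π (WithLp.ofLp x) = WithLp.ofLp x := by
    funext i
    rcases lt_or_ge (x i) (lo i) with h | h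
    · have h3 : π (WithLp.ofLp x) i = lo i := by
        simp only [π]
        rw [min_eq_right (by linarith [hle i]), max_eq_left h.le]
      have := hlo _ (hπm _) i h3
      have := hxi i
      linarith
    · rcases lt_or_ge (hi i) (x i) with h' | h'
      · have h3 : π (WithLp.ofLp x) i = hi i := by
          simp only [π]
          rw [min_eq_left h'.le, max_eq_right (hle i)]
        have := hhi _ (hπm _) i h3
        have := hxi i
        linarith
      · simp only [π]
        rw [min_eq_right h', max_eq_right h]
  refine ⟨π (WithLp.ofLp x), hπm _, fun i => ?_⟩
  have := hxi i
  have h4 := congrFun hfix i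
  linarith

theorem vh_periodic_solutions {m : ℕ} {l1 l2 h1 h2 : ℝ} (hl : l1 ≤ l2) (hh : h1 ≤ h2)
    (f : Fin m → ℝ × ℝ × ℝ → ℝ) (g : ℝ × ℝ × ℝ → ℝ)
    (hf : ∀ j, ContinuousOn (f j) (Set.Icc l1 l2 ×ˢ Set.Icc h1 h2 ×ˢ Set.Icc h1 h2))
    (hg : ContinuousOn g (Set.Icc h1 h2 ×ˢ Set.Icc l1 l2 ×ˢ Set.Icc l1 l2))
    (hf1 : ∀ j, ∀ q ∈ Set.Icc h1 h2, ∀ q' ∈ Set.Icc h1 h2, f j (l1, q, q') < 0)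
    (hf2 : ∀ j, ∀ q ∈ Set.Icc h1 h2, ∀ q' ∈ Set.Icc h1 h2, 0 < f j (l2, q, q'))
    (hg1 : ∀ p ∈ Set.Icc l1 l2, ∀ p' ∈ Set.Icc l1 l2, g (h1, p, p') < 0)
    (hg2 : ∀ p ∈ Set.Icc l1 l2, ∀ p' ∈ Set.Icc l1 l2, 0 < g (h2, p, p'))
    (s : ℤ → Fin m) (k : ℕ) (hk : 1 ≤ k) (hs : ∀ i, s (i + (k : ℤ)) = s i) :
    ∃ p q : ℤ → ℝ, (∀ i, p i ∈ Set.Icc l1 l2) ∧ (∀ i, q i ∈ Set.Icc h1 h2) ∧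
      (∀ i, f (s i) (p i, q i, q (i + 1)) = 0) ∧ (∀ i, g (q (i + 1), p i, p (i + 1)) = 0) ∧
      (∀ i, p (i + (k : ℤ)) = p i) ∧ (∀ i, q (i + (k : ℤ)) = q i) := by
  classical
  have : NeZero k := ⟨by omega⟩
  let s' : ZMod k → Fin m := fun x => s (x.val : ℤ)
  have hs' : ∀ i : ℤ, s' (i : ZMod k) = s i := by
    intro i
    have hper : Function.Periodic s (k : ℤ) := hs
    have h3 : ∀ n : ℤ, s (i % k + n * k) = s (i % k) := fun n => hper.int_mul n _
    simp only [s']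
    rw [ZMod.val_intCast, ← h3 (i / k)]
    congr 1
    rw [mul_comm]; exact Int.emod_add_mul_ediv i k
  let F : (ZMod k ⊕ ZMod k → ℝ) → (ZMod k ⊕ ZMod k → ℝ) := fun x =>
    Sum.elim (fun i => f (s' i) (x (.inl i), x (.inr i), x (.inr (i + 1))))
      (fun i => g (x (.inr i), x (.inl (i - 1)), x (.inl i)))
  let lo : ZMod k ⊕ ZMod k → ℝ := Sum.elim (fun _ => l1) (fun _ => h1)
  let hi : ZMod k ⊕ ZMod k → ℝ := Sum.elim (fun _ => l2) (fun _ => h2)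
  have hml : ∀ x ∈ Set.Icc lo hi, ∀ i, x (.inl i) ∈ Set.Icc l1 l2 := fun x hx i =>
    ⟨hx.1 (.inl i), hx.2 (.inl i)⟩
  have hmr : ∀ x ∈ Set.Icc lo hi, ∀ i, x (.inr i) ∈ Set.Icc h1 h2 := fun x hx i =>
    ⟨hx.1 (.inr i), hx.2 (.inr i)⟩
  obtain ⟨x, hx, hx0⟩ := vh_poincare_miranda lo hi (by rintro (i | i) <;> simp [lo, hi, hl, hh]) F
    (by
      refine continuousOn_pi.2 ?_
      rintro (i | i)
      · refine (hf (s' i)).comp (f := fun x : ZMod k ⊕ ZMod k → ℝ =>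
          (x (.inl i), x (.inr i), x (.inr (i + 1)))) (by fun_prop) ?_
        exact fun x hx => ⟨hml x hx _, hmr x hx _, hmr x hx _⟩
      · refine hg.comp (f := fun x : ZMod k ⊕ ZMod k → ℝ =>
          (x (.inr i), x (.inl (i - 1)), x (.inl i))) (by fun_prop) ?_
        exact fun x hx => ⟨hmr x hx _, hml x hx _, hml x hx _⟩)
    (by
      rintro x hx (i | i) h
      · have h : x (.inl i) = l1 := h
        simp only [F, Sum.elim_inl, h]
        exact hf1 _ _ (hmr x hx _) _ (hmr x hx _)
      · have h : x (.inr i) = h1 := h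
        simp only [F, Sum.elim_inr, h]
        exact hg1 _ (hml x hx _) _ (hml x hx _))
    (by
      rintro x hx (i | i) h
      · have h : x (.inl i) = l2 := h
        simp only [F, Sum.elim_inl, h]
        exact hf2 _ _ (hmr x hx _) _ (hmr x hx _)
      · have h : x (.inr i) = h2 := h
        simp only [F, Sum.elim_inr, h]
        exact hg2 _ (hml x hx _) _ (hml x hx _))
  refine ⟨fun i => x (.inl (i : ZMod k)), fun i => x (.inr (i : ZMod k)), fun i => hml x hx _,
    fun i => hmr x hx _, fun i => ?_, fun i => ?_, fun i => ?_, fun i => ?_⟩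
  · have := hx0 (.inl (i : ZMod k))
    simp only [F, Sum.elim_inl, hs'] at this
    simpa using this
  · have := hx0 (.inr ((i + 1 : ℤ) : ZMod k))
    simp only [F, Sum.elim_inr] at this
    simpa using this
  · simp
  · simp

theorem vh_solutions {m : ℕ} {l1 l2 h1 h2 : ℝ} (hl : l1 ≤ l2) (hh : h1 ≤ h2)
    (f : Fin m → ℝ × ℝ × ℝ → ℝ) (g : ℝ × ℝ × ℝ → ℝ)
    (hf : ∀ j, ContinuousOn (f j) (Set.Icc l1 l2 ×ˢ Set.Icc h1 h2 ×ˢ Set.Icc h1 h2))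
    (hg : ContinuousOn g (Set.Icc h1 h2 ×ˢ Set.Icc l1 l2 ×ˢ Set.Icc l1 l2))
    (hf1 : ∀ j, ∀ q ∈ Set.Icc h1 h2, ∀ q' ∈ Set.Icc h1 h2, f j (l1, q, q') < 0)
    (hf2 : ∀ j, ∀ q ∈ Set.Icc h1 h2, ∀ q' ∈ Set.Icc h1 h2, 0 < f j (l2, q, q'))
    (hg1 : ∀ p ∈ Set.Icc l1 l2, ∀ p' ∈ Set.Icc l1 l2, g (h1, p, p') < 0)
    (hg2 : ∀ p ∈ Set.Icc l1 l2, ∀ p' ∈ Set.Icc l1 l2, 0 < g (h2, p, p'))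
    (s : ℤ → Fin m) :
    ∃ p q : ℤ → ℝ, (∀ i, p i ∈ Set.Icc l1 l2) ∧ (∀ i, q i ∈ Set.Icc h1 h2) ∧
      (∀ i, f (s i) (p i, q i, q (i + 1)) = 0) ∧ (∀ i, g (q (i + 1), p i, p (i + 1)) = 0) := by
  let S : ℕ → ℤ → Fin m := fun N i => s ((i + N) % ((2 * N + 1 : ℕ) : ℤ) - N)
  have hS : ∀ N : ℕ, ∀ i : ℤ, |i| ≤ N → S N i = s i := by
    intro N i hi
    simp only [S]
    rw [abs_le] at hi
    rw [Int.emod_eq_of_lt (by omega) (by push_cast; omega)]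
    congr 1; omega
  have hex := fun N : ℕ => vh_periodic_solutions hl hh f g hf hg hf1 hf2 hg1 hg2 (S N) (2 * N + 1)
    (by omega) (fun i => by
      simp only [S]
      rw [show i + ((2 * N + 1 : ℕ) : ℤ) + N = i + N + ((2 * N + 1 : ℕ) : ℤ) by ring,
        Int.add_emod_right])
  choose P Q hP hQ hfz hgz _ _ using hex
  have hcomp : IsCompact ((Set.univ.pi fun _ : ℤ => Set.Icc l1 l2) ×ˢ
      (Set.univ.pi fun _ : ℤ => Set.Icc h1 h2)) :=
    (isCompact_univ_pi fun _ => isCompact_Icc).prod (isCompact_univ_pi fun _ => isCompact_Icc)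
  obtain ⟨⟨p, q⟩, hpq, σ, hσ, hlim⟩ := hcomp.tendsto_subseq (x := fun N => (P N, Q N))
    (fun N => ⟨fun i _ => hP N i, fun i _ => hQ N i⟩)
  have hp : ∀ i, p i ∈ Set.Icc l1 l2 := fun i => hpq.1 i (Set.mem_univ _)
  have hq : ∀ i, q i ∈ Set.Icc h1 h2 := fun i => hpq.2 i (Set.mem_univ _)
  have hPl : ∀ i, Filter.Tendsto (fun N => P (σ N) i) Filter.atTop (nhds (p i)) := fun i =>
    (((continuous_apply i).comp continuous_fst).tendsto (p, q)).comp hlim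
  have hQl : ∀ i, Filter.Tendsto (fun N => Q (σ N) i) Filter.atTop (nhds (q i)) := fun i =>
    (((continuous_apply i).comp continuous_snd).tendsto (p, q)).comp hlim
  refine ⟨p, q, hp, hq, fun i => ?_, fun i => ?_⟩
  · have h3 : Filter.Tendsto (fun N => f (s i) (P (σ N) i, Q (σ N) i, Q (σ N) (i + 1))) Filter.atTop
        (nhds (f (s i) (p i, q i, q (i + 1)))) := by
      refine ((hf (s i)) (p i, q i, q (i + 1)) ⟨hp _, hq _, hq _⟩).tendsto.comp ?_
      refine tendsto_nhdsWithin_iff.2 ⟨(hPl i).prodMk_nhds ((hQl i).prodMk_nhds (hQl (i + 1))), ?_⟩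
      exact Filter.Eventually.of_forall fun N => ⟨hP _ _, hQ _ _, hQ _ _⟩
    refine tendsto_nhds_unique h3 (tendsto_const_nhds.congr' ?_)
    filter_upwards [Filter.eventually_ge_atTop i.natAbs] with N hN
    have h4 := hfz (σ N) i
    rw [hS (σ N) i (by have := hσ.id_le N; simp only [id] at this; rw [Int.abs_eq_natAbs]; omega)] at h4
    exact h4.symm
  · have h3 : Filter.Tendsto (fun N => g (Q (σ N) (i + 1), P (σ N) i, P (σ N) (i + 1))) Filter.atTop
        (nhds (g (q (i + 1), p i, p (i + 1)))) := by
      refine (hg (q (i + 1), p i, p (i + 1)) ⟨hq _, hp _, hp _⟩).tendsto.comp ?_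
      refine tendsto_nhdsWithin_iff.2 ⟨(hQl _).prodMk_nhds ((hPl i).prodMk_nhds (hPl (i + 1))), ?_⟩
      exact Filter.Eventually.of_forall fun N => ⟨hQ _ _, hP _ _, hP _ _⟩
    refine tendsto_nhds_unique h3 (tendsto_const_nhds.congr' ?_)
    exact Filter.Eventually.of_forall fun N => (hgz (σ N) i).symm

theorem vh_chaos {m : ℕ} {l1 l2 h1 h2 : ℝ} (hl : l1 ≤ l2) (hh : h1 ≤ h2)
    (f : Fin m → ℝ × ℝ × ℝ → ℝ) (g : ℝ × ℝ × ℝ → ℝ)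
    (hf : ∀ j, ContinuousOn (f j) (Set.Icc l1 l2 ×ˢ Set.Icc h1 h2 ×ˢ Set.Icc h1 h2))
    (hg : ContinuousOn g (Set.Icc h1 h2 ×ˢ Set.Icc l1 l2 ×ˢ Set.Icc l1 l2))
    (hf1 : ∀ j, ∀ q ∈ Set.Icc h1 h2, ∀ q' ∈ Set.Icc h1 h2, f j (l1, q, q') < 0)
    (hf2 : ∀ j, ∀ q ∈ Set.Icc h1 h2, ∀ q' ∈ Set.Icc h1 h2, 0 < f j (l2, q, q'))
    (hg1 : ∀ p ∈ Set.Icc l1 l2, ∀ p' ∈ Set.Icc l1 l2, g (h1, p, p') < 0)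
    (hg2 : ∀ p ∈ Set.Icc l1 l2, ∀ p' ∈ Set.Icc l1 l2, 0 < g (h2, p, p'))
    (Z : ℝ × ℝ → ℝ × ℝ) (hZ : ContinuousOn Z (Set.Icc l1 l2 ×ˢ Set.Icc h1 h2))
    (hZi : Set.InjOn Z (Set.Icc l1 l2 ×ˢ Set.Icc h1 h2))
    (R : Set (ℝ × ℝ)) (hZR : ∀ p ∈ Set.Icc l1 l2, ∀ q ∈ Set.Icc h1 h2, Z (p, q) ∈ R)
    (φ ψ : ℝ × ℝ → ℝ × ℝ)
    (hφ : ∀ j, ∀ p ∈ Set.Icc l1 l2, ∀ q ∈ Set.Icc h1 h2, ∀ q' ∈ Set.Icc h1 h2,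
      f j (p, q, q') = 0 → φ (Z (p, q)) = Z (p, q'))
    (hψ : ∀ q ∈ Set.Icc h1 h2, ∀ p ∈ Set.Icc l1 l2, ∀ p' ∈ Set.Icc l1 l2,
      g (q, p, p') = 0 → ψ (Z (p, q)) = Z (p', q))
    (hj : ∀ i j, ∀ p ∈ Set.Icc l1 l2, ∀ q ∈ Set.Icc h1 h2, ∀ q' ∈ Set.Icc h1 h2,
      f i (p, q, q') = 0 → f j (p, q, q') = 0 → i = j) :
    InducesChaoticDynamics (ψ ∘ φ) R m := by
  let K : Fin m → Set (ℝ × ℝ) := fun j => (fun x : ℝ × ℝ × ℝ => Z (x.1, x.2.1)) ''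
    ((Set.Icc l1 l2 ×ˢ Set.Icc h1 h2 ×ˢ Set.Icc h1 h2) ∩ f j ⁻¹' {0})
  have hK : ∀ j, ∀ p ∈ Set.Icc l1 l2, ∀ q ∈ Set.Icc h1 h2, ∀ q' ∈ Set.Icc h1 h2,
      f j (p, q, q') = 0 → Z (p, q) ∈ K j := fun j p hp q hq q' hq' h0 =>
    ⟨(p, q, q'), ⟨⟨hp, hq, hq'⟩, h0⟩, rfl⟩
  have horb : ∀ p q : ℤ → ℝ, (∀ i, p i ∈ Set.Icc l1 l2) → (∀ i, q i ∈ Set.Icc h1 h2) →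
      ∀ s : ℤ → Fin m, (∀ i, f (s i) (p i, q i, q (i + 1)) = 0) →
      (∀ i, g (q (i + 1), p i, p (i + 1)) = 0) →
      (∀ i, Z (p i, q i) ∈ K (s i)) ∧
        ∀ i, Z (p (i + 1), q (i + 1)) = (ψ ∘ φ) (Z (p i, q i)) := by
    intro p q hp hq s h3 h4
    refine ⟨fun i => hK _ _ (hp i) _ (hq i) _ (hq (i+1)) (h3 i), fun i => ?_⟩
    rw [Function.comp_apply, hφ _ _ (hp i) _ (hq i) _ (hq (i+1)) (h3 i),
      hψ _ (hq (i+1)) _ (hp i) _ (hp (i+1)) (h4 i)]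
  refine ⟨K, fun j => ⟨?_, ?_, ?_⟩, ?_, ?_, ?_⟩
  · obtain ⟨p, q, hp, hq, h3, h4⟩ := vh_solutions hl hh f g hf hg hf1 hf2 hg1 hg2 (fun _ => j)
    exact ⟨_, hK _ _ (hp 0) _ (hq 0) _ (hq (0+1)) (h3 0)⟩
  · have hbox : IsCompact (Set.Icc l1 l2 ×ˢ Set.Icc h1 h2 ×ˢ Set.Icc h1 h2) :=
      isCompact_Icc.prod (isCompact_Icc.prod isCompact_Icc)
    refine (hbox.of_isClosed_subset ((hf j).preimage_isClosed_of_isClosed hbox.isClosed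
      isClosed_singleton) Set.inter_subset_left).image_of_continuousOn ?_
    refine hZ.comp (f := fun x : ℝ × ℝ × ℝ => (x.1, x.2.1)) (by fun_prop) ?_
    exact fun x hx => ⟨hx.1.1, hx.1.2.1⟩
  · rintro _ ⟨x, hx, rfl⟩
    exact hZR _ hx.1.1 _ hx.1.2.1
  · intro i j hij
    rw [Set.disjoint_left]
    rintro z ⟨⟨p, q, q'⟩, ⟨⟨hp, hq, hq'⟩, h0⟩, rfl⟩ ⟨⟨p2, q2, q2'⟩, ⟨⟨hp2, hq2, hq2'⟩, h02⟩, he⟩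
    simp only at hp hq hq' hp2 hq2 hq2' he
    have h5 := hZi (show (p2, q2) ∈ _ from ⟨hp2, hq2⟩) (show (p, q) ∈ _ from ⟨hp, hq⟩) he
    simp only [Prod.mk.injEq] at h5
    obtain ⟨rfl, rfl⟩ := h5
    have h6 := hφ i _ hp _ hq _ hq' h0
    rw [hφ j _ hp _ hq _ hq2' h02] at h6
    have h7 := hZi (show (p2, q2') ∈ _ from ⟨hp2, hq2'⟩) (show (p2, q') ∈ _ from ⟨hp, hq'⟩) h6
    simp only [Prod.mk.injEq, true_and] at h7
    subst h7
    exact hij (hj i j _ hp _ hq _ hq' h0 h02)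
  · intro s
    obtain ⟨p, q, hp, hq, h3, h4⟩ := vh_solutions hl hh f g hf hg hf1 hf2 hg1 hg2 s
    exact ⟨fun i => Z (p i, q i), horb p q hp hq s h3 h4⟩
  · intro s k hk hs
    obtain ⟨p, q, hp, hq, h3, h4, h5, h6⟩ :=
      vh_periodic_solutions hl hh f g hf hg hf1 hf2 hg1 hg2 s k hk hs
    obtain ⟨h7, h8⟩ := horb p q hp hq s h3 h4
    exact ⟨fun i => Z (p i, q i), h7, h8, fun i => by simp only [h5, h6]⟩

theorem vh_k_pos {u : ℝ} (hu : u ≠ 0) : 0 < Real.exp u - u - 1 := by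
  have := Real.add_one_lt_exp hu
  linarith

theorem vh_k_nonneg (u : ℝ) : 0 ≤ Real.exp u - u - 1 := by
  have := Real.add_one_le_exp u
  linarith

/-- signed square root of `exp u - u - 1` -/
noncomputable def vhPhi (u : ℝ) : ℝ :=
  if 0 ≤ u then √(Real.exp u - u - 1) else -√(Real.exp u - u - 1)

/-- derivative of `vhPhi` -/
noncomputable def vhSig (u : ℝ) : ℝ :=
  √(if u = 0 then 1 / 2 else (Real.exp u - 1) ^ 2 / (4 * (Real.exp u - u - 1)))

theorem vhPhi_sq (u : ℝ) : vhPhi u ^ 2 = Real.exp u - u - 1 := by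
  unfold vhPhi
  split_ifs <;> simp [Real.sq_sqrt (vh_k_nonneg u)]

theorem vhPhi_zero : vhPhi 0 = 0 := by simp [vhPhi]

theorem vhPhi_continuous : Continuous vhPhi := by
  unfold vhPhi
  refine Continuous.if_le (by fun_prop) (by fun_prop) continuous_const continuous_id ?_
  intro x hx
  simp [← hx]

theorem vhSig_pos (u : ℝ) : 0 < vhSig u := by
  unfold vhSig
  apply Real.sqrt_pos.2
  split_ifs with h
  · norm_num
  · have h1 := vh_k_pos h
    have h2 : Real.exp u - 1 ≠ 0 := by
      intro h3
      exact h (Real.exp_eq_one_iff u |>.1 (by linarith))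
    positivity

theorem vhSig_mul (u : ℝ) : Real.exp u - 1 = 2 * (vhPhi u * vhSig u) := by
  rcases lt_trichotomy u 0 with h | h | h
  · have h1 := vh_k_pos h.ne
    have h2 : Real.exp u < 1 := Real.exp_lt_one_iff.2 h
    simp only [vhPhi, vhSig, not_le.2 h, h.ne, if_false]
    rw [neg_mul, ← Real.sqrt_mul h1.le, show (Real.exp u - u - 1) *
      ((Real.exp u - 1) ^ 2 / (4 * (Real.exp u - u - 1))) = ((1 - Real.exp u) / 2) ^ 2 by
      field_simp; ring, Real.sqrt_sq (by linarith)]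
    ring
  · subst h; simp [vhPhi_zero]
  · have h1 := vh_k_pos h.ne'
    have h2 : 1 < Real.exp u := Real.one_lt_exp_iff.2 h
    simp only [vhPhi, vhSig, h.le, h.ne', if_false, if_true]
    rw [← Real.sqrt_mul h1.le, show (Real.exp u - u - 1) *
      ((Real.exp u - 1) ^ 2 / (4 * (Real.exp u - u - 1))) = ((Real.exp u - 1) / 2) ^ 2 by
      field_simp; ring, Real.sqrt_sq (by linarith)]
    ring

theorem vhSig_continuous : Continuous vhSig := by
  unfold vhSig
  refine Real.continuous_sqrt.comp ?_
  rw [continuous_iff_continuousAt]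
  intro u
  by_cases hu : u = 0
  · subst hu
    rw [continuousAt_iff_punctured_nhds]
    simp only [if_true]
    have h1 : Filter.Tendsto (fun u : ℝ => (Real.exp u - 1) ^ 2 / (4 * (Real.exp u - u - 1)))
        (nhdsWithin 0 {0}ᶜ) (nhds (1/2)) := by
      have hne : ∀ᶠ x : ℝ in nhdsWithin 0 {0}ᶜ, x ≠ 0 := self_mem_nhdsWithin
      refine HasDerivAt.lhopital_zero_nhdsNE (f' := fun u => 2 * (Real.exp u - 1) * Real.exp u)
        (g' := fun u => 4 * (Real.exp u - 1)) ?_ ?_ ?_ ?_ ?_ ?_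
      · refine Filter.Eventually.of_forall fun x => ?_
        have := ((Real.hasDerivAt_exp x).sub_const 1).pow 2
        refine this.congr_deriv ?_
        simp
      · refine Filter.Eventually.of_forall fun x => ?_
        have := ((((Real.hasDerivAt_exp x).sub (hasDerivAt_id x)).sub_const 1).const_mul 4)
        simpa using this
      · filter_upwards [hne] with x hx h3
        exact hx (Real.exp_eq_one_iff x |>.1 (by linarith))
      · have : Continuous fun u : ℝ => (Real.exp u - 1) ^ 2 := by fun_prop
        have h4 := this.tendsto 0
        simp only [Real.exp_zero, sub_self, ne_eq, OfNat.ofNat_ne_zero, not_false_eq_true,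
          zero_pow] at h4
        exact h4.mono_left nhdsWithin_le_nhds
      · have : Continuous fun u : ℝ => 4 * (Real.exp u - u - 1) := by fun_prop
        have h4 := this.tendsto 0
        simp only [Real.exp_zero, sub_zero, sub_self, mul_zero] at h4
        exact h4.mono_left nhdsWithin_le_nhds
      · have : Continuous fun u : ℝ => Real.exp u / 2 := by fun_prop
        have h4 := this.tendsto 0
        simp only [Real.exp_zero] at h4
        refine (h4.mono_left nhdsWithin_le_nhds).congr' ?_
        filter_upwards [hne] with x hx
        have : Real.exp x - 1 ≠ 0 := fun h3 => hx (Real.exp_eq_one_iff x |>.1 (by linarith))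
        field_simp
        norm_num
    refine h1.congr' ?_
    filter_upwards [self_mem_nhdsWithin] with x hx
    rw [if_neg (show x ≠ 0 from hx)]
  · have h1 := vh_k_pos hu
    have : ContinuousAt (fun u : ℝ => (Real.exp u - 1) ^ 2 / (4 * (Real.exp u - u - 1))) u := by
      refine ContinuousAt.div (by fun_prop) (by fun_prop) (by positivity)
    refine this.congr ?_
    filter_upwards [isOpen_ne.mem_nhds hu] with x hx
    rw [if_neg hx]

theorem vhPhi_hasDerivAt (u : ℝ) : HasDerivAt vhPhi (vhSig u) u := by
  have hk : ∀ u : ℝ, HasDerivAt (fun u : ℝ => Real.exp u - u - 1) (Real.exp u - 1) u := fun u =>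
    (((Real.hasDerivAt_exp u).sub (hasDerivAt_id u)).sub_const 1)
  have key : ∀ y, y ≠ 0 → HasDerivAt vhPhi (vhSig y) y := by
    intro y hy
    have h1 := vh_k_pos hy
    have h2 := (hk y).sqrt h1.ne'
    have hm := vhSig_mul y
    rcases lt_or_gt_of_ne hy with h | h
    · have h3 : HasDerivAt vhPhi (-((Real.exp y - 1) / (2 * √(Real.exp y - y - 1)))) y := by
        refine h2.neg.congr_of_eventuallyEq ?_
        filter_upwards [isOpen_Iio.mem_nhds h] with x hx
        simp [vhPhi, not_le.2 (Set.mem_Iio.1 hx)]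
      convert h3 using 1
      have hs := Real.sqrt_pos.2 h1
      simp only [vhPhi, not_le.2 h, if_false] at hm
      field_simp
      linarith
    · have h3 : HasDerivAt vhPhi ((Real.exp y - 1) / (2 * √(Real.exp y - y - 1))) y := by
        refine h2.congr_of_eventuallyEq ?_
        filter_upwards [isOpen_Ioi.mem_nhds h] with x hx
        simp [vhPhi, (Set.mem_Ioi.1 hx).le]
      convert h3 using 1
      have hs := Real.sqrt_pos.2 h1
      simp only [vhPhi, h.le, if_true] at hm
      field_simp
      linarith
  by_cases hu : u = 0
  · subst hu
    exact hasDerivAt_of_hasDerivAt_of_ne key vhPhi_continuous.continuousAt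
      vhSig_continuous.continuousAt
  · exact key u hu

theorem vhPhi_strictMono : StrictMono vhPhi :=
  strictMono_of_hasDerivAt_pos vhPhi_hasDerivAt vhSig_pos

theorem vhPhi_surjective : Function.Surjective vhPhi := by
  refine vhPhi_continuous.surjective ?_ ?_
  · refine Filter.Tendsto.congr' (f₁ := fun u => √(Real.exp u - u - 1)) ?_ ?_
    · filter_upwards [Filter.eventually_ge_atTop 0] with x hx
      simp [vhPhi, hx]
    · refine Real.tendsto_sqrt_atTop.comp ?_
      refine Filter.tendsto_atTop_mono' _ ?_
        ((Filter.tendsto_pow_atTop (α := ℝ) two_ne_zero).atTop_div_const (two_pos))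
      filter_upwards [Filter.eventually_ge_atTop 0] with x hx
      have := Real.quadratic_le_exp_of_nonneg hx
      linarith
  · refine Filter.Tendsto.congr' (f₁ := fun u => -√(Real.exp u - u - 1)) ?_ ?_
    · filter_upwards [Filter.eventually_lt_atBot 0] with x hx
      simp [vhPhi, not_le.2 hx]
    · refine Filter.tendsto_neg_atTop_atBot.comp (Real.tendsto_sqrt_atTop.comp ?_)
      refine Filter.tendsto_atTop_mono (f := fun x : ℝ => -x + (-1)) (fun x => ?_)
        (Filter.tendsto_atTop_add_const_right _ _ Filter.tendsto_neg_atBot_atTop)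
      have := Real.exp_pos x
      linarith

/-- `vhPhi` as an order isomorphism -/
noncomputable def vhIso : ℝ ≃o ℝ := vhPhi_strictMono.orderIsoOfSurjective vhPhi vhPhi_surjective

/-- inverse of `vhPhi` -/
noncomputable def vhU (X : ℝ) : ℝ := vhIso.symm X

theorem vhPhi_U (X : ℝ) : vhPhi (vhU X) = X := vhIso.apply_symm_apply X

theorem vhU_Phi (u : ℝ) : vhU (vhPhi u) = u := vhIso.symm_apply_apply u

theorem vhU_continuous : Continuous vhU := vhIso.symm.continuous

theorem vhU_nonneg {X : ℝ} (h : 0 ≤ X) : 0 ≤ vhU X := by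
  rw [← vhPhi_strictMono.le_iff_le, vhPhi_U, vhPhi_zero]; exact h

theorem vhU_nonpos {X : ℝ} (h : X ≤ 0) : vhU X ≤ 0 := by
  rw [← vhPhi_strictMono.le_iff_le, vhPhi_U, vhPhi_zero]; exact h

/-- derivative of `vhU` -/
noncomputable def vhG (X : ℝ) : ℝ := (vhSig (vhU X))⁻¹

theorem vhG_pos (X : ℝ) : 0 < vhG X := inv_pos.2 (vhSig_pos _)

theorem vhG_continuous : Continuous vhG :=
  (vhSig_continuous.comp vhU_continuous).inv₀ fun _ => (vhSig_pos _).ne'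

theorem vhU_hasDerivAt (X : ℝ) : HasDerivAt vhU (vhG X) X :=
  HasDerivAt.of_local_left_inverse vhU_continuous.continuousAt (vhPhi_hasDerivAt _)
    (vhSig_pos _).ne' (Filter.Eventually.of_forall vhPhi_U)

theorem vh_J_pos {u : ℝ} (hu : u ≠ 0) :
    0 < (Real.exp u - 1) ^ 3 / 3 + 1 - Real.exp u ^ 2 + 2 * u * Real.exp u := by
  let k : ℝ → ℝ := fun u => Real.exp u ^ 2 - 4 * Real.exp u + 3 + 2 * u
  have hkd : ∀ u, HasDerivAt k (2 * (Real.exp u - 1) ^ 2) u := by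
    intro u
    have := (((((Real.hasDerivAt_exp u).pow 2).sub ((Real.hasDerivAt_exp u).const_mul 4)).add_const
      3).add ((hasDerivAt_id u).const_mul 2))
    refine this.congr_deriv ?_
    simp
    ring
  have hk0 : k 0 = 0 := by simp [k]; norm_num
  have hkc : Continuous k := by simp only [k]; fun_prop
  have hkm1 : StrictMonoOn k (Set.Ici 0) := by
    refine strictMonoOn_of_deriv_pos (convex_Ici 0) hkc.continuousOn fun x hx => ?_
    rw [(hkd x).deriv]
    rw [interior_Ici] at hx
    have : 1 < Real.exp x := Real.one_lt_exp_iff.2 hx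
    have : 0 < Real.exp x - 1 := by linarith
    positivity
  have hkm2 : StrictMonoOn k (Set.Iic 0) := by
    refine strictMonoOn_of_deriv_pos (convex_Iic 0) hkc.continuousOn fun x hx => ?_
    rw [(hkd x).deriv]
    rw [interior_Iic] at hx
    have : Real.exp x < 1 := Real.exp_lt_one_iff.2 hx
    have : Real.exp x - 1 ≠ 0 := by linarith
    positivity
  let J : ℝ → ℝ := fun u => (Real.exp u - 1) ^ 3 / 3 + 1 - Real.exp u ^ 2 + 2 * u * Real.exp u
  have hJd : ∀ u, HasDerivAt J (Real.exp u * k u) u := by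
    intro u
    have := ((((((Real.hasDerivAt_exp u).sub_const 1).pow 3).div_const 3).add_const 1).sub
      ((Real.hasDerivAt_exp u).pow 2)).add
        (((hasDerivAt_id u).const_mul 2).mul (Real.hasDerivAt_exp u))
    refine this.congr_deriv ?_
    simp [k]
    ring
  have hJ0 : J 0 = 0 := by simp [J]
  have hJc : Continuous J := by simp only [J]; fun_prop
  change 0 < J u
  rcases lt_or_gt_of_ne hu with h | h
  · have : StrictAntiOn J (Set.Iic 0) := by
      refine strictAntiOn_of_deriv_neg (convex_Iic 0) hJc.continuousOn fun x hx => ?_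
      rw [(hJd x).deriv]
      rw [interior_Iic] at hx
      have h1 := hkm2 (Set.mem_Iic.2 (le_of_lt hx)) (Set.mem_Iic.2 le_rfl) hx
      rw [hk0] at h1
      nlinarith [Real.exp_pos x]
    have h2 := this (Set.mem_Iic.2 h.le) (Set.mem_Iic.2 le_rfl) h
    rwa [hJ0] at h2
  · have : StrictMonoOn J (Set.Ici 0) := by
      refine strictMonoOn_of_deriv_pos (convex_Ici 0) hJc.continuousOn fun x hx => ?_
      rw [(hJd x).deriv]
      rw [interior_Ici] at hx
      have h1 := hkm1 (Set.mem_Ici.2 le_rfl) (Set.mem_Ici.2 (le_of_lt hx)) hx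
      rw [hk0] at h1
      have := Real.exp_pos x
      positivity
    have h2 := this (Set.mem_Ici.2 le_rfl) (Set.mem_Ici.2 h.le) h
    rwa [hJ0] at h2

theorem vhG_deriv {X : ℝ} (hX : X ≠ 0) : ∃ D, HasDerivAt vhG D X ∧
    (0 < X → -(2/3) < D) ∧ (X < 0 → D < -(2/3)) := by
  have hform : ∀ X, X ≠ 0 → vhG X = 2 * X / (Real.exp (vhU X) - 1) := by
    intro X hX
    have h := vhSig_mul (vhU X)
    rw [vhPhi_U] at h
    have := vhSig_pos (vhU X)
    rw [h, vhG]
    field_simp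
  have hU0 : vhU X ≠ 0 := fun h => hX (by rw [← vhPhi_U X, h, vhPhi_zero])
  have hE : Real.exp (vhU X) - 1 ≠ 0 := fun h =>
    hU0 (Real.exp_eq_one_iff _ |>.1 (by linarith))
  have hd := ((hasDerivAt_id X).const_mul 2).div (((vhU_hasDerivAt X).exp).sub_const 1) hE
  have hd2 : HasDerivAt vhG _ X := hd.congr_of_eventuallyEq (by
    filter_upwards [isOpen_ne.mem_nhds hX] with y hy
    exact hform y hy)
  have hsq := vhPhi_sq (vhU X)
  rw [vhPhi_U] at hsq
  have hval : (2 * 1 * (Real.exp (vhU X) - 1) - 2 * id X * (Real.exp (vhU X) * vhG X)) /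
      (Real.exp (vhU X) - 1) ^ 2 =
      2 * (-Real.exp (vhU X) ^ 2 + 1 + 2 * vhU X * Real.exp (vhU X)) /
        (Real.exp (vhU X) - 1) ^ 3 := by
    rw [hform X hX]
    simp only [id]
    field_simp
    rw [hsq]
    ring
  have hJ := vh_J_pos hU0
  refine ⟨_, hd2, fun h => ?_, fun h => ?_⟩
  · have h1 : 0 < vhU X := lt_of_le_of_ne (vhU_nonneg h.le) hU0.symm
    have h2 : 0 < Real.exp (vhU X) - 1 := by
      have := Real.one_lt_exp_iff.2 h1
      linarith
    rw [hval, lt_div_iff₀ (by positivity)]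
    linarith
  · have h1 : vhU X < 0 := lt_of_le_of_ne (vhU_nonpos h.le) hU0
    have h2 : Real.exp (vhU X) - 1 < 0 := by
      have := Real.exp_lt_one_iff.2 h1
      linarith
    have h3 : (Real.exp (vhU X) - 1) ^ 3 < 0 := Odd.pow_neg (by decide) h2
    rw [hval, div_lt_iff_of_neg h3]
    linarith

/-- twice the even part of `vhG` -/
noncomputable def vhW (X : ℝ) : ℝ := vhG X + vhG (-X)

theorem vhW_neg (X : ℝ) : vhW (-X) = vhW X := by simp [vhW, add_comm]

theorem vhW_pos (X : ℝ) : 0 < vhW X := add_pos (vhG_pos _) (vhG_pos _)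

theorem vhW_continuous : Continuous vhW :=
  vhG_continuous.add (vhG_continuous.comp continuous_neg)

theorem vhW_strictMonoOn : StrictMonoOn vhW (Set.Ici 0) := by
  refine strictMonoOn_of_deriv_pos (convex_Ici 0) vhW_continuous.continuousOn fun X hX => ?_
  rw [interior_Ici] at hX
  have hX : 0 < X := hX
  obtain ⟨D1, h1, h2, -⟩ := vhG_deriv hX.ne'
  obtain ⟨D2, h3, -, h4⟩ := vhG_deriv (neg_ne_zero.2 hX.ne')
  have h5 : HasDerivAt vhW (D1 + D2 * (-1)) X := h1.add (h3.comp X (hasDerivAt_neg X))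
  rw [h5.deriv]
  have := h2 hX
  have := h4 (by linarith)
  linarith

theorem vhW_abs (X : ℝ) : vhW |X| = vhW X := by
  rcases abs_choice X with h | h <;> rw [h]
  exact vhW_neg X

/-- time element along the level curve of radius `ρ` -/
noncomputable def vhOm (a c ρ θ : ℝ) : ℝ :=
  vhG (ρ * Real.cos θ / √c) * vhG (ρ * Real.sin θ / √a) / (2 * (√a * √c))

/-- elapsed time along the level curve -/
noncomputable def vhS (a c ρ θ : ℝ) : ℝ := ∫ s in (0:ℝ)..θ, vhOm a c ρ s

/-- period of the level curve -/
noncomputable def vhT (a c ρ : ℝ) : ℝ := vhS a c ρ (2 * Real.pi)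

theorem vhOm_comp {α : Type*} [TopologicalSpace α] (a c : ℝ) {f g : α → ℝ} (hf : Continuous f)
    (hg : Continuous g) : Continuous fun p => vhOm a c (f p) (g p) := by
  unfold vhOm
  have h1 : Continuous fun p => vhG (f p * Real.cos (g p) / √c) :=
    vhG_continuous.comp (by fun_prop)
  have h2 : Continuous fun p => vhG (f p * Real.sin (g p) / √a) :=
    vhG_continuous.comp (by fun_prop)
  exact (h1.mul h2).div_const _

theorem vhOm_cont (a c ρ : ℝ) : Continuous (vhOm a c ρ) :=
  vhOm_comp a c continuous_const continuous_id

theorem vhOm_pos {a c : ℝ} (ha : 0 < a) (hc : 0 < c) (ρ θ : ℝ) : 0 < vhOm a c ρ θ := by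
  have := vhG_pos (ρ * Real.cos θ / √c)
  have := vhG_pos (ρ * Real.sin θ / √a)
  have := Real.sqrt_pos.2 ha
  have := Real.sqrt_pos.2 hc
  unfold vhOm
  positivity

theorem vhOm_periodic (a c ρ : ℝ) : Function.Periodic (vhOm a c ρ) (2 * Real.pi) := by
  intro θ
  simp [vhOm, Real.cos_add_two_pi, Real.sin_add_two_pi]

theorem vhS_continuous (a c : ℝ) : Continuous fun p : ℝ × ℝ => vhS a c p.1 p.2 := by
  unfold vhS
  refine intervalIntegral.continuous_parametric_intervalIntegral_of_continuous
    (μ := MeasureTheory.volume) (f := fun (p : ℝ × ℝ) s => vhOm a c p.1 s) (a₀ := 0) ?_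
    continuous_snd
  exact vhOm_comp a c (f := fun q : (ℝ × ℝ) × ℝ => q.1.1) (g := fun q => q.2) (by fun_prop)
    (by fun_prop)

theorem vhS_hasDerivAt (a c ρ θ : ℝ) : HasDerivAt (vhS a c ρ) (vhOm a c ρ θ) θ :=
  intervalIntegral.integral_hasDerivAt_right ((vhOm_cont a c ρ).intervalIntegrable _ _)
    (vhOm_cont a c ρ).aestronglyMeasurable.stronglyMeasurableAtFilter
    (vhOm_cont a c ρ).continuousAt

theorem vhS_strictMono {a c : ℝ} (ha : 0 < a) (hc : 0 < c) (ρ : ℝ) : StrictMono (vhS a c ρ) :=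
  strictMono_of_hasDerivAt_pos (vhS_hasDerivAt a c ρ) (vhOm_pos ha hc ρ)

theorem vhS_add (a c ρ θ : ℝ) (n : ℤ) :
    vhS a c ρ (θ + n * (2 * Real.pi)) = vhS a c ρ θ + n * vhT a c ρ := by
  have hi : ∀ t₁ t₂, IntervalIntegrable (vhOm a c ρ) MeasureTheory.volume t₁ t₂ :=
    fun t₁ t₂ => (vhOm_cont a c ρ).intervalIntegrable _ _
  have h1 := (vhOm_periodic a c ρ).intervalIntegral_add_zsmul_eq n θ hi
  have h2 := (vhOm_periodic a c ρ).intervalIntegral_add_eq θ 0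
  have h3 := intervalIntegral.integral_add_adjacent_intervals (hi 0 θ) (hi θ (θ + n • (2 * Real.pi)))
  rw [h1, h2, zero_add] at h3
  simp only [zsmul_eq_mul] at h3
  exact h3.symm

theorem vhT_continuous (a c : ℝ) : Continuous (vhT a c) :=
  Continuous.comp (g := fun p : ℝ × ℝ => vhS a c p.1 p.2) (f := fun ρ => (ρ, 2 * Real.pi))
    (vhS_continuous a c) (by fun_prop)

theorem vhT_pos {a c : ℝ} (ha : 0 < a) (hc : 0 < c) (ρ : ℝ) : 0 < vhT a c ρ := by
  have := vhS_strictMono ha hc ρ (show (0:ℝ) < 2 * Real.pi by positivity)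
  simpa [vhS, vhT] using this

theorem vhT_four (a c ρ : ℝ) : 4 * vhT a c ρ = ∫ θ in (0:ℝ)..(2 * Real.pi),
    vhW (ρ * Real.cos θ / √c) * vhW (ρ * Real.sin θ / √a) / (2 * (√a * √c)) := by
  have hi : ∀ t₁ t₂, IntervalIntegrable (vhOm a c ρ) MeasureTheory.volume t₁ t₂ :=
    fun t₁ t₂ => (vhOm_cont a c ρ).intervalIntegrable _ _
  have hper := (vhOm_periodic a c ρ)
  have hT : vhT a c ρ = ∫ θ in (0:ℝ)..(2 * Real.pi), vhOm a c ρ θ := rfl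
  have h1 : ∫ θ in (0:ℝ)..(2 * Real.pi), vhOm a c ρ (-θ) = vhT a c ρ := by
    rw [intervalIntegral.integral_comp_neg (fun θ => vhOm a c ρ θ), hT]
    have := hper.intervalIntegral_add_eq (-(2 * Real.pi)) 0
    simpa using this
  have h2 : ∫ θ in (0:ℝ)..(2 * Real.pi), vhOm a c ρ (Real.pi - θ) = vhT a c ρ := by
    rw [intervalIntegral.integral_comp_sub_left (fun θ => vhOm a c ρ θ), hT]
    have := hper.intervalIntegral_add_eq (Real.pi - 2 * Real.pi) 0
    rw [zero_add] at this
    rw [← this]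
    congr 1
    ring
  have h3 : ∫ θ in (0:ℝ)..(2 * Real.pi), vhOm a c ρ (θ + Real.pi) = vhT a c ρ := by
    rw [intervalIntegral.integral_comp_add_right (fun θ => vhOm a c ρ θ), hT]
    have := hper.intervalIntegral_add_eq (0 + Real.pi) 0
    rw [zero_add (2 * Real.pi)] at this
    rw [← this]
    congr 1
    ring
  have hc := vhOm_cont a c ρ
  have i1 : IntervalIntegrable (fun θ => vhOm a c ρ (-θ)) MeasureTheory.volume 0 (2 * Real.pi) :=
    (hc.comp (by fun_prop)).intervalIntegrable _ _
  have i2 : IntervalIntegrable (fun θ => vhOm a c ρ (Real.pi - θ)) MeasureTheory.volume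
    0 (2 * Real.pi) := (hc.comp (by fun_prop)).intervalIntegrable _ _
  have i3 : IntervalIntegrable (fun θ => vhOm a c ρ (θ + Real.pi)) MeasureTheory.volume
    0 (2 * Real.pi) := (hc.comp (by fun_prop)).intervalIntegrable _ _
  have : 4 * vhT a c ρ = (∫ θ in (0:ℝ)..(2 * Real.pi), vhOm a c ρ θ) +
      (∫ θ in (0:ℝ)..(2 * Real.pi), vhOm a c ρ (-θ)) +
      (∫ θ in (0:ℝ)..(2 * Real.pi), vhOm a c ρ (Real.pi - θ)) +
      ∫ θ in (0:ℝ)..(2 * Real.pi), vhOm a c ρ (θ + Real.pi) := by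
    rw [h1, h2, h3, ← hT]; ring
  rw [this, ← intervalIntegral.integral_add (hi _ _) i1,
    ← intervalIntegral.integral_add ((hi _ _).add i1) i2,
    ← intervalIntegral.integral_add (((hi _ _).add i1).add i2) i3]
  refine intervalIntegral.integral_congr fun θ _ => ?_
  simp only [vhOm, vhW, Real.cos_neg, Real.sin_neg, Real.cos_pi_sub, Real.sin_pi_sub,
    Real.cos_add_pi, Real.sin_add_pi, mul_neg, neg_div]
  ring

theorem vhW_le {X Y : ℝ} (h : |X| ≤ |Y|) : vhW X ≤ vhW Y := by
  rw [← vhW_abs X, ← vhW_abs Y]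
  exact vhW_strictMonoOn.monotoneOn (abs_nonneg X) (abs_nonneg Y) h

theorem vhW_lt {X Y : ℝ} (h : |X| < |Y|) : vhW X < vhW Y := by
  rw [← vhW_abs X, ← vhW_abs Y]
  exact vhW_strictMonoOn (abs_nonneg X) (abs_nonneg Y) h

theorem vhT_strictMonoOn {a c : ℝ} (ha : 0 < a) (hc : 0 < c) :
    StrictMonoOn (vhT a c) (Set.Ici 0) := by
  intro ρ hρ ρ' hρ' h
  have hρ : 0 ≤ ρ := hρ
  have hρ' : 0 ≤ ρ' := hρ'
  have sa := Real.sqrt_pos.2 ha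
  have sc := Real.sqrt_pos.2 hc
  suffices 4 * vhT a c ρ < 4 * vhT a c ρ' by linarith
  rw [vhT_four, vhT_four]
  have hcont : ∀ ρ : ℝ, Continuous fun θ : ℝ =>
      vhW (ρ * Real.cos θ / √c) * vhW (ρ * Real.sin θ / √a) / (2 * (√a * √c)) := by
    intro ρ
    have h1 : Continuous fun θ : ℝ => vhW (ρ * Real.cos θ / √c) :=
      vhW_continuous.comp (by fun_prop)
    have h2 : Continuous fun θ : ℝ => vhW (ρ * Real.sin θ / √a) :=
      vhW_continuous.comp (by fun_prop)
    exact (h1.mul h2).div_const _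
  have hle : ∀ (t s : ℝ), 0 < s → |ρ * t / s| ≤ |ρ' * t / s| := by
    intro t s hs
    rw [abs_div, abs_div, abs_mul, abs_mul, abs_of_nonneg hρ, abs_of_nonneg hρ']
    gcongr
  refine intervalIntegral.integral_lt_integral_of_continuousOn_of_le_of_exists_lt (by positivity)
    (hcont ρ).continuousOn (hcont ρ').continuousOn ?_ ?_
  · intro θ _
    have := vhW_le (hle (Real.cos θ) _ sc)
    have := vhW_le (hle (Real.sin θ) _ sa)
    have := vhW_pos (ρ * Real.cos θ / √c)
    have := vhW_pos (ρ * Real.sin θ / √a)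
    have := vhW_pos (ρ' * Real.cos θ / √c)
    gcongr
  · refine ⟨0, ⟨le_rfl, by positivity⟩, ?_⟩
    have h1 : vhW (ρ * Real.cos 0 / √c) < vhW (ρ' * Real.cos 0 / √c) := by
      apply vhW_lt
      simp only [Real.cos_zero, mul_one]
      rw [abs_of_nonneg (by positivity), abs_of_nonneg (by positivity)]
      gcongr
    have := vhW_pos 0
    simp only [Real.sin_zero, mul_zero, zero_div]
    gcongr

/-- first rotation coordinate -/
noncomputable def vhX (c d : ℝ) (x : ℝ) : ℝ := √c * vhPhi (Real.log x - Real.log (c / d))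

theorem vhX_sq {c d x : ℝ} (hc : 0 < c) (hd : 0 < d) (hx : 0 < x) :
    vhX c d x ^ 2 = d * x - c * Real.log x - (d * (c / d) - c * Real.log (c / d)) := by
  unfold vhX
  rw [mul_pow, vhPhi_sq, Real.sq_sqrt hc.le, Real.exp_sub, Real.exp_log hx,
    Real.exp_log (by positivity)]
  field_simp
  ring

theorem vhX_inj {c d x y : ℝ} (hc : 0 < c) (hx : 0 < x) (hy : 0 < y)
    (h : vhX c d x = vhX c d y) : x = y := by
  have sc := Real.sqrt_pos.2 hc
  have h1 := vhPhi_strictMono.injective (mul_left_cancel₀ sc.ne' h)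
  exact Real.log_injOn_pos hx hy (by linarith)

theorem vhX_continuousOn (c d : ℝ) : ContinuousOn (vhX c d) (Set.Ioi 0) := by
  unfold vhX
  refine continuousOn_const.mul (vhPhi_continuous.comp_continuousOn ?_)
  refine ContinuousOn.sub (Real.continuousOn_log.mono ?_) continuousOn_const
  intro x hx
  exact (ne_of_gt hx)

/-- speed factor -/
noncomputable def vhR (c d : ℝ) (x : ℝ) : ℝ := √c * vhSig (Real.log x - Real.log (c / d))

theorem vhX_mul {c d x : ℝ} (hc : 0 < c) (hd : 0 < d) (hx : 0 < x) :
    d * x - c = 2 * (vhX c d x * vhR c d x) := by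
  unfold vhX vhR
  have h := vhSig_mul (Real.log x - Real.log (c / d))
  rw [Real.exp_sub, Real.exp_log hx, Real.exp_log (by positivity)] at h
  have hs := Real.mul_self_sqrt hc.le
  have h2 : d * x - c = c * (x / (c / d) - 1) := by field_simp
  rw [h2, h]
  generalize √c = s at *
  rw [← hs]
  ring

theorem vh_const {f : ℝ → ℝ} {r : ℝ}
    (hf : ∀ t ∈ Set.Icc (0:ℝ) r, HasDerivWithinAt f 0 (Set.Icc (0:ℝ) r) t) :
    ∀ t ∈ Set.Icc (0:ℝ) r, f t = f 0 := by
  intro t ht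
  have := (convex_Icc (0:ℝ) r).norm_image_sub_le_of_norm_hasDerivWithin_le (C := 0) hf
    (fun x _ => by simp) (Set.left_mem_Icc.2 (ht.1.trans ht.2)) ht
  rw [zero_mul, norm_le_zero_iff, sub_eq_zero] at this
  exact this

theorem vh_flow {a b c d r ρ θ₀ : ℝ} (ha : 0 < a) (hb : 0 < b) (hc : 0 < c) (hd : 0 < d)
    (hr : 0 ≤ r) (ζ : ℝ → ℝ × ℝ) (hζ : ∀ t ∈ Set.Icc (0 : ℝ) r, 0 < (ζ t).1 ∧ 0 < (ζ t).2)
    (hζd : ∀ t ∈ Set.Icc (0 : ℝ) r, HasDerivWithinAt ζ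
      ((ζ t).1 * (a - b * (ζ t).2), (ζ t).2 * (-c + d * (ζ t).1)) (Set.Icc (0 : ℝ) r) t)
    (hX0 : vhX c d (ζ 0).1 = ρ * Real.cos θ₀) (hY0 : vhX a b (ζ 0).2 = ρ * Real.sin θ₀) :
    ∃ θ, vhX c d (ζ r).1 = ρ * Real.cos θ ∧ vhX a b (ζ r).2 = ρ * Real.sin θ ∧
      vhS a c ρ θ = vhS a c ρ θ₀ + r := by
  have sa := Real.sqrt_pos.2 ha
  have sc := Real.sqrt_pos.2 hc
  set I := Set.Icc (0:ℝ) r with hI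
  have hx : ∀ t ∈ I, HasDerivWithinAt (fun t => (ζ t).1) ((ζ t).1 * (a - b * (ζ t).2)) I t :=
    fun t ht => (hasFDerivAt_fst (𝕜 := ℝ) (p := ζ t)).comp_hasDerivWithinAt t (hζd t ht)
  have hy : ∀ t ∈ I, HasDerivWithinAt (fun t => (ζ t).2) ((ζ t).2 * (-c + d * (ζ t).1)) I t :=
    fun t ht => (hasFDerivAt_snd (𝕜 := ℝ) (p := ζ t)).comp_hasDerivWithinAt t (hζd t ht)
  set om : ℝ → ℝ := fun t => 2 * (vhR c d (ζ t).1 * vhR a b (ζ t).2) with hom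
  have hX : ∀ t ∈ I, HasDerivWithinAt (fun t => vhX c d (ζ t).1) (-(om t * vhX a b (ζ t).2)) I t := by
    intro t ht
    have h1 := (((vhPhi_hasDerivAt _).comp_hasDerivWithinAt t
      (((hx t ht).log (hζ t ht).1.ne').sub_const (Real.log (c / d)))).const_mul (√c))
    refine h1.congr_deriv ?_
    have h2 := vhX_mul ha hb (hζ t ht).2
    rw [mul_div_cancel_left₀ _ (hζ t ht).1.ne', hom]
    simp only [vhR] at h2 ⊢
    linear_combination -(√c * vhSig (Real.log (ζ t).1 - Real.log (c / d))) * h2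
  have hY : ∀ t ∈ I, HasDerivWithinAt (fun t => vhX a b (ζ t).2) ((om t * vhX c d (ζ t).1)) I t := by
    intro t ht
    have h1 := (((vhPhi_hasDerivAt _).comp_hasDerivWithinAt t
      (((hy t ht).log (hζ t ht).2.ne').sub_const (Real.log (a / b)))).const_mul (√a))
    refine h1.congr_deriv ?_
    have h2 := vhX_mul hc hd (hζ t ht).1
    rw [mul_div_cancel_left₀ _ (hζ t ht).2.ne', hom]
    simp only [vhR] at h2 ⊢
    linear_combination (√a * vhSig (Real.log (ζ t).2 - Real.log (a / b))) * h2
  have homc : ContinuousOn om I := by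
    have hl : ∀ t ∈ I, ContinuousWithinAt (fun t => Real.log (ζ t).1) I t := fun t ht =>
      ((hx t ht).log (hζ t ht).1.ne').continuousWithinAt
    have hl2 : ∀ t ∈ I, ContinuousWithinAt (fun t => Real.log (ζ t).2) I t := fun t ht =>
      ((hy t ht).log (hζ t ht).2.ne').continuousWithinAt
    refine continuousOn_const.mul (ContinuousOn.mul (continuousOn_const.mul
      (vhSig_continuous.comp_continuousOn (ContinuousOn.sub hl continuousOn_const)))
      (continuousOn_const.mul
      (vhSig_continuous.comp_continuousOn (ContinuousOn.sub hl2 continuousOn_const))))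
  set om' : ℝ → ℝ := Set.IccExtend hr (I.domRestrict om) with hom'
  have hom'c : Continuous om' := (continuousOn_iff_continuous_domRestrict.1 homc).Icc_extend'
  have hom'e : ∀ t ∈ I, om' t = om t := by
    intro t ht
    rw [hom', Set.IccExtend_of_mem hr _ ht]
    rfl
  set th : ℝ → ℝ := fun t => θ₀ + ∫ s in (0:ℝ)..t, om' s with hth
  have hth0 : th 0 = θ₀ := by simp [hth]
  have hthd : ∀ t ∈ I, HasDerivWithinAt th (om t) I t := by
    intro t ht
    have h1 := intervalIntegral.integral_hasDerivAt_right (hom'c.intervalIntegrable 0 t)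
      hom'c.aestronglyMeasurable.stronglyMeasurableAtFilter hom'c.continuousAt
    rw [hom'e t ht] at h1
    exact (h1.const_add θ₀).hasDerivWithinAt
  have hF1 := vh_const (f := fun t => vhX c d (ζ t).1 * Real.cos (th t) +
      vhX a b (ζ t).2 * Real.sin (th t)) (r := r) (fun t ht => by
    have := ((hX t ht).mul (hthd t ht).cos).add ((hY t ht).mul (hthd t ht).sin)
    refine this.congr_deriv ?_
    ring)
  have hF2 := vh_const (f := fun t => vhX c d (ζ t).1 * Real.sin (th t) -
      vhX a b (ζ t).2 * Real.cos (th t)) (r := r) (fun t ht => by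
    have := ((hX t ht).mul (hthd t ht).sin).sub ((hY t ht).mul (hthd t ht).cos)
    refine this.congr_deriv ?_
    ring)
  simp only [hth0, hX0, hY0] at hF1 hF2
  have hXt : ∀ t ∈ I, vhX c d (ζ t).1 = ρ * Real.cos (th t) := by
    intro t ht
    have h1 := hF1 t ht
    have h2 := hF2 t ht
    have h3 := Real.sin_sq_add_cos_sq (th t)
    have h4 := Real.sin_sq_add_cos_sq θ₀
    linear_combination Real.cos (th t) * h1 + Real.sin (th t) * h2 - vhX c d (ζ t).1 * h3 +
      ρ * Real.cos (th t) * h4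
  have hYt : ∀ t ∈ I, vhX a b (ζ t).2 = ρ * Real.sin (th t) := by
    intro t ht
    have h1 := hF1 t ht
    have h2 := hF2 t ht
    have h3 := Real.sin_sq_add_cos_sq (th t)
    have h4 := Real.sin_sq_add_cos_sq θ₀
    linear_combination Real.sin (th t) * h1 - Real.cos (th t) * h2 - vhX a b (ζ t).2 * h3 +
      ρ * Real.sin (th t) * h4
  have hG : ∀ (c d x : ℝ), 0 < c → vhG (vhX c d x / √c) * vhR c d x = √c := by
    intro c d x hc
    have sc := Real.sqrt_pos.2 hc
    unfold vhX vhR vhG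
    rw [mul_div_cancel_left₀ _ sc.ne', vhU_Phi]
    have := vhSig_pos (Real.log x - Real.log (c / d))
    field_simp
  have hF3 := vh_const (f := fun t => vhS a c ρ (th t) - t) (r := r) (fun t ht => by
    have := ((vhS_hasDerivAt a c ρ (th t)).comp_hasDerivWithinAt t (hthd t ht)).sub
      (hasDerivWithinAt_id t I)
    refine this.congr_deriv ?_
    have h1 := hG c d (ζ t).1 hc
    have h2 := hG a b (ζ t).2 ha
    simp only [vhOm, hom]
    rw [← hXt t ht, ← hYt t ht]
    have h3 : vhG (vhX c d (ζ t).1 / √c) * vhG (vhX a b (ζ t).2 / √a) / (2 * (√a * √c)) *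
      (2 * (vhR c d (ζ t).1 * vhR a b (ζ t).2)) = (vhG (vhX c d (ζ t).1 / √c) * vhR c d (ζ t).1) *
      (vhG (vhX a b (ζ t).2 / √a) * vhR a b (ζ t).2) / (√a * √c) := by
      field_simp
    rw [h3, h1, h2]
    field_simp
    ring)
  have hrI : r ∈ I := Set.right_mem_Icc.2 hr
  refine ⟨th r, hXt r hrI, hYt r hrI, ?_⟩
  have := hF3 r hrI
  simp only [hth0] at this
  linarith

/-- the energy -/
noncomputable def vhE (a b c d : ℝ) (z : ℝ × ℝ) : ℝ :=
  d * z.1 - c * Real.log z.1 + b * z.2 - a * Real.log z.2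

/-- the period as function of the energy -/
noncomputable def vhTE (a b c d e : ℝ) : ℝ := vhT a c √(e - vhE a b c d (c / d, a / b))

/-- the one-sided domain -/
def vhD (a b c d σ : ℝ) : Set (ℝ × ℝ) :=
  {z | 0 < z.1 ∧ 0 < z.2 ∧ 0 ≤ σ * (d * z.1 + b * z.2 - (a + c)) ∧
    vhE a b c d (c / d, a / b) < vhE a b c d z}

theorem vhE_sq {a b c d : ℝ} (ha : 0 < a) (hb : 0 < b) (hc : 0 < c) (hd : 0 < d) {z : ℝ × ℝ}
    (h1 : 0 < z.1) (h2 : 0 < z.2) :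
    vhE a b c d z - vhE a b c d (c / d, a / b) = vhX c d z.1 ^ 2 + vhX a b z.2 ^ 2 := by
  rw [vhX_sq hc hd h1, vhX_sq ha hb h2]
  simp only [vhE]
  ring

theorem vhE_continuousOn (a b c d : ℝ) :
    ContinuousOn (vhE a b c d) (Set.Ioi 0 ×ˢ Set.Ioi 0) := by
  unfold vhE
  have h1 : ContinuousOn (fun z : ℝ × ℝ => Real.log z.1) (Set.Ioi 0 ×ˢ Set.Ioi 0) :=
    ContinuousOn.log (by fun_prop) fun z hz => (ne_of_gt hz.1)
  have h2 : ContinuousOn (fun z : ℝ × ℝ => Real.log z.2) (Set.Ioi 0 ×ˢ Set.Ioi 0) :=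
    ContinuousOn.log (by fun_prop) fun z hz => (ne_of_gt hz.2)
  fun_prop

theorem vhTE_continuous (a b c d : ℝ) : Continuous (vhTE a b c d) := by
  unfold vhTE
  exact (vhT_continuous a c).comp (by fun_prop)

theorem vhTE_pos {a b c d : ℝ} (ha : 0 < a) (hc : 0 < c) (e : ℝ) : 0 < vhTE a b c d e :=
  vhT_pos ha hc _

theorem vhTE_lt {a b c d : ℝ} (ha : 0 < a) (hc : 0 < c) {e e' : ℝ}
    (he : vhE a b c d (c / d, a / b) < e) (h : e < e') : vhTE a b c d e < vhTE a b c d e' := by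
  refine vhT_strictMonoOn ha hc (Real.sqrt_nonneg _) (Real.sqrt_nonneg _) ?_
  exact Real.sqrt_lt_sqrt (by linarith) (by linarith)

/-- complex number used for the angle -/
noncomputable def vhC (a b c d σ : ℝ) (z : ℝ × ℝ) : ℂ :=
  ⟨σ * (vhX c d z.1 + vhX a b z.2), σ * (vhX a b z.2 - vhX c d z.1)⟩

/-- angle lift -/
noncomputable def vhTh (a b c d σ : ℝ) (z : ℝ × ℝ) : ℝ :=
  Complex.arg (vhC a b c d σ z) + (Real.pi / 4 + (1 - σ) / 2 * Real.pi)

/-- time coordinate -/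
noncomputable def vhA (a b c d σ : ℝ) (z : ℝ × ℝ) : ℝ :=
  vhS a c √(vhE a b c d z - vhE a b c d (c / d, a / b)) (vhTh a b c d σ z)

theorem vhTh_spec {a b c d σ : ℝ} (ha : 0 < a) (hb : 0 < b) (hc : 0 < c) (hd : 0 < d)
    (hσ : σ = 1 ∨ σ = -1) {z : ℝ × ℝ} (h1 : 0 < z.1) (h2 : 0 < z.2) :
    vhX c d z.1 = √(vhE a b c d z - vhE a b c d (c / d, a / b)) * Real.cos (vhTh a b c d σ z) ∧
    vhX a b z.2 = √(vhE a b c d z - vhE a b c d (c / d, a / b)) * Real.sin (vhTh a b c d σ z) := by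
  rw [vhE_sq ha hb hc hd h1 h2]
  set X := vhX c d z.1 with hX
  set Y := vhX a b z.2 with hY
  set w := vhC a b c d σ z with hw
  have hre : w.re = σ * (X + Y) := rfl
  have him : w.im = σ * (Y - X) := rfl
  have hn : ‖w‖ = √2 * √(X ^ 2 + Y ^ 2) := by
    rw [Complex.norm_eq_sqrt_sq_add_sq, hre, him, ← Real.sqrt_mul (by norm_num)]
    congr 1
    rcases hσ with h | h <;> rw [h] <;> ring
  have hcs := Complex.norm_mul_cos_arg w
  have hsn := Complex.norm_mul_sin_arg w
  rw [hre, hn] at hcs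
  rw [him, hn] at hsn
  have e1 : √(X ^ 2 + Y ^ 2) * Real.cos (Complex.arg w + Real.pi / 4) = σ * X := by
    rw [Real.cos_add, Real.cos_pi_div_four, Real.sin_pi_div_four]
    linear_combination (1/2) * hcs - (1/2) * hsn
  have e2 : √(X ^ 2 + Y ^ 2) * Real.sin (Complex.arg w + Real.pi / 4) = σ * Y := by
    rw [Real.sin_add, Real.cos_pi_div_four, Real.sin_pi_div_four]
    linear_combination (1/2) * hcs + (1/2) * hsn
  unfold vhTh
  rw [← hw]
  rcases hσ with h | h
  · rw [show Complex.arg w + (Real.pi / 4 + (1 - σ) / 2 * Real.pi) = Complex.arg w + Real.pi / 4 by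
      rw [h]; ring, e1, e2, h]
    constructor <;> ring
  · rw [show Complex.arg w + (Real.pi / 4 + (1 - σ) / 2 * Real.pi) =
      Complex.arg w + Real.pi / 4 + Real.pi by rw [h]; ring, Real.cos_add_pi, Real.sin_add_pi]
    rw [h] at e1 e2
    constructor <;> linarith

theorem vhC_slit {a b c d σ : ℝ} (ha : 0 < a) (hb : 0 < b) (hc : 0 < c) (hd : 0 < d)
    (hσ : σ = 1 ∨ σ = -1) {z : ℝ × ℝ} (hz : z ∈ vhD a b c d σ) :
    vhC a b c d σ z ∈ Complex.slitPlane := by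
  obtain ⟨h1, h2, h3, h4⟩ := hz
  rw [Complex.mem_slitPlane_iff]
  have hE := vhE_sq ha hb hc hd h1 h2
  have m1 := vhX_mul hc hd h1
  have m2 := vhX_mul ha hb h2
  have p1 : 0 < vhR c d z.1 := mul_pos (Real.sqrt_pos.2 hc) (vhSig_pos _)
  have p2 : 0 < vhR a b z.2 := mul_pos (Real.sqrt_pos.2 ha) (vhSig_pos _)
  simp only [vhC]
  generalize vhX c d z.1 = X at *
  generalize vhX a b z.2 = Y at *
  by_contra! hcon
  obtain ⟨c1, c2⟩ := hcon
  have hσ0 : σ ≠ 0 := by rcases hσ with h | h <;> rw [h] <;> norm_num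
  have hXY : Y = X := by
    have := (mul_eq_zero.1 c2).resolve_left hσ0
    linarith
  subst hXY
  have h5 : 0 ≤ 2 * (σ * Y) * (vhR c d z.1 + vhR a b z.2) := by
    have : σ * (d * z.1 + b * z.2 - (a + c)) = 2 * (σ * Y) * (vhR c d z.1 + vhR a b z.2) := by
      linear_combination σ * m1 + σ * m2
    linarith
  have h6 : 0 ≤ 2 * (σ * Y) := nonneg_of_mul_nonneg_left h5 (by positivity)
  have h7 : σ * Y = 0 := by linarith
  have h8 := (mul_eq_zero.1 h7).resolve_left hσ0
  rw [h8] at hE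
  linarith

theorem vhA_continuousOn {a b c d σ : ℝ} (ha : 0 < a) (hb : 0 < b) (hc : 0 < c) (hd : 0 < d)
    (hσ : σ = 1 ∨ σ = -1) : ContinuousOn (vhA a b c d σ) (vhD a b c d σ) := by
  have hsub : vhD a b c d σ ⊆ Set.Ioi 0 ×ˢ Set.Ioi 0 := fun z hz => ⟨hz.1, hz.2.1⟩
  have hE := (vhE_continuousOn a b c d).mono hsub
  have hX : ContinuousOn (fun z : ℝ × ℝ => vhX c d z.1) (vhD a b c d σ) :=
    (vhX_continuousOn c d).comp continuousOn_fst fun z hz => hz.1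
  have hY : ContinuousOn (fun z : ℝ × ℝ => vhX a b z.2) (vhD a b c d σ) :=
    (vhX_continuousOn a b).comp continuousOn_snd fun z hz => hz.2.1
  have hC : ContinuousOn (vhC a b c d σ) (vhD a b c d σ) := by
    have : vhC a b c d σ = fun z => ((σ * (vhX c d z.1 + vhX a b z.2) : ℝ) : ℂ) +
        ((σ * (vhX a b z.2 - vhX c d z.1) : ℝ) : ℂ) * Complex.I := by
      funext z
      apply Complex.ext <;> simp [vhC]
    rw [this]
    refine ContinuousOn.add (Complex.continuous_ofReal.comp_continuousOn ?_)
      ((Complex.continuous_ofReal.comp_continuousOn ?_).mul continuousOn_const)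
    · exact continuousOn_const.mul (hX.add hY)
    · exact continuousOn_const.mul (hY.sub hX)
  have hTh : ContinuousOn (vhTh a b c d σ) (vhD a b c d σ) := by
    unfold vhTh
    refine ContinuousOn.add (fun z hz => ?_) continuousOn_const
    exact (Complex.continuousAt_arg (vhC_slit ha hb hc hd hσ hz)).comp_continuousWithinAt (hC z hz)
  have hpair : ContinuousOn (fun z => (√(vhE a b c d z - vhE a b c d (c / d, a / b)),
      vhTh a b c d σ z)) (vhD a b c d σ) :=
    ContinuousOn.prodMk (Real.continuous_sqrt.comp_continuousOn (hE.sub continuousOn_const)) hTh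
  have key := Continuous.comp_continuousOn (g := fun p : ℝ × ℝ => vhS a c p.1 p.2)
    (vhS_continuous a c) hpair
  unfold vhA
  simpa only [Function.comp_def] using key

theorem vhA_lt {a b c d σ : ℝ} (ha : 0 < a) (hc : 0 < c) {z z' : ℝ × ℝ}
    (h : vhE a b c d z = vhE a b c d z') :
    vhA a b c d σ z' - vhA a b c d σ z < vhTE a b c d (vhE a b c d z) := by
  have hS := vhS_add a c √(vhE a b c d z - vhE a b c d (c / d, a / b)) (vhTh a b c d σ z) 1
  have hm := vhS_strictMono ha hc √(vhE a b c d z - vhE a b c d (c / d, a / b))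
    (show vhTh a b c d σ z' < vhTh a b c d σ z + (1:ℤ) * (2 * Real.pi) by
      have h1 := Complex.neg_pi_lt_arg (vhC a b c d σ z)
      have h2 := Complex.arg_le_pi (vhC a b c d σ z')
      simp only [vhTh]
      push_cast
      linarith)
  rw [hS] at hm
  simp only [vhA, vhTE, ← h]
  push_cast at hm
  linarith

theorem vhA_flow {a b c d σ r : ℝ} (ha : 0 < a) (hb : 0 < b) (hc : 0 < c) (hd : 0 < d)
    (hσ : σ = 1 ∨ σ = -1)
    (hr : 0 ≤ r) (ζ : ℝ → ℝ × ℝ) (hζ : ∀ t ∈ Set.Icc (0 : ℝ) r, 0 < (ζ t).1 ∧ 0 < (ζ t).2)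
    (hζd : ∀ t ∈ Set.Icc (0 : ℝ) r, HasDerivWithinAt ζ
      ((ζ t).1 * (a - b * (ζ t).2), (ζ t).2 * (-c + d * (ζ t).1)) (Set.Icc (0 : ℝ) r) t)
    {z' : ℝ × ℝ} (hz' : z' ∈ vhD a b c d σ) (h : vhE a b c d (ζ 0) = vhE a b c d z') (n : ℤ)
    (hn : vhA a b c d σ z' - vhA a b c d σ (ζ 0) + n * vhTE a b c d (vhE a b c d z') = r) :
    ζ r = z' := by
  have h0 := hζ 0 (Set.left_mem_Icc.2 hr)
  have h1 := hζ r (Set.right_mem_Icc.2 hr)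
  obtain ⟨e1, e2⟩ := vhTh_spec ha hb hc hd hσ h0.1 h0.2
  obtain ⟨e3, e4⟩ := vhTh_spec ha hb hc hd hσ hz'.1 hz'.2.1
  obtain ⟨θ, g1, g2, g3⟩ := vh_flow ha hb hc hd hr ζ hζ hζd e1 e2
  simp only [vhA, vhTE] at hn
  rw [h] at g1 g2 g3 hn
  have hS := vhS_add a c √(vhE a b c d z' - vhE a b c d (c / d, a / b)) (vhTh a b c d σ z') n
  have hθ : θ = vhTh a b c d σ z' + n * (2 * Real.pi) := by
    apply (vhS_strictMono ha hc √(vhE a b c d z' - vhE a b c d (c / d, a / b))).injective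
    rw [hS, g3]
    linarith
  rw [hθ, Real.cos_add_int_mul_two_pi, ← e3] at g1
  rw [hθ, Real.sin_add_int_mul_two_pi, ← e4] at g2
  exact Prod.ext (vhX_inj hc h1.1 hz'.1 g1) (vhX_inj ha h1.2 hz'.2.1 g2)

theorem vh_convex {a b c d K : ℝ} (ha : 0 < a) (hb : 0 < b) (hc : 0 < c) (hd : 0 < d) :
    ConvexOn ℝ (Set.Ioo 0 (K / d)) fun x => vhE a b c d (x, (K - d * x) / b) := by
  refine ⟨convex_Ioo _ _, fun x hx y hy α β hα hβ hαβ => ?_⟩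
  have hpos : ∀ x ∈ Set.Ioo 0 (K / d), 0 < (K - d * x) / b := by
    intro x hx
    have := (lt_div_iff₀ hd).1 hx.2
    apply div_pos _ hb
    linarith
  have h1 := strictConcaveOn_log_Ioi.concaveOn.2 (x := x) (y := y) hx.1 hy.1 hα hβ hαβ
  have h2 := strictConcaveOn_log_Ioi.concaveOn.2 (hpos x hx) (hpos y hy) hα hβ hαβ
  simp only [smul_eq_mul] at h1 h2 ⊢
  have h3 : (K - d * (α * x + β * y)) / b = α * ((K - d * x) / b) + β * ((K - d * y) / b) := by
    have : K = α * K + β * K := by rw [← add_mul, hαβ, one_mul]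
    field_simp
    linarith
  simp only [vhE]
  rw [h3]
  have h4 := mul_le_mul_of_nonneg_left h1 hc.le
  have h5 := mul_le_mul_of_nonneg_left h2 ha.le
  nlinarith

theorem vh_line_cont {a b c d K : ℝ} (hb : 0 < b) (hd : 0 < d) :
    ContinuousOn (fun x => vhE a b c d (x, (K - d * x) / b)) (Set.Ioo 0 (K / d)) := by
  refine (vhE_continuousOn a b c d).comp (by fun_prop) fun x hx => ⟨hx.1, ?_⟩
  have := (lt_div_iff₀ hd).1 hx.2
  apply div_pos _ hb
  linarith

theorem vh_diff (a b c d μ : ℝ) (z : ℝ × ℝ) : vhE (a - μ) b (c + μ) d z - vhE a b c d z =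
    μ * (Real.log z.2 - Real.log z.1) := by
  simp only [vhE]; ring

theorem vh_key {a b c d μ l1 l2 h1 h2 p1m p1p p2p q1m q2m q1p x p q : ℝ}
    (ha : 0 < a) (hb : 0 < b) (hc : 0 < c) (hd : 0 < d)
    (hμ : 0 < μ) (hμa : μ < a) {e eμ : ℝ → ℝ}
    (he : e = fun x => vhE a b c d (x, (a + c - d * x) / b))
    (heμ : eμ = fun x => vhE (a - μ) b (c + μ) d (x, (a + c - d * x) / b))
    {I : Set ℝ} (hI : I = Set.Ioo 0 ((a + c) / d))
    (i1 : p1m ∈ I) (i2 : p1p ∈ I) (i4 : q1m ∈ I) (i6 : q1p ∈ I)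
    (v1 : e p1m = l1) (v2 : e p1p = l1) (v3 : e p2p = l2)
    (v4 : eμ q1m = h1) (v5 : eμ q2m = h2) (v6 : eμ q1p = h1)
    (hl : l1 < l2) (hh : h1 < h2)
    (o1 : p1m ≤ q2m) (o2 : q2m < q1m) (o3 : q1m ≤ p1p) (o4 : p1p < p2p) (o5 : p2p ≤ q1p)
    (hp : p ∈ Set.Icc l1 l2) (hq : q ∈ Set.Icc h1 h2) (hx : x ∈ I)
    (hδ : eμ x - e x = q - p) : e x ≤ p := by
  have hc1 : ConvexOn ℝ I e := by rw [he, hI]; exact vh_convex ha hb hc hd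
  have hc2 : ConvexOn ℝ I eμ := by
    rw [heμ, hI]; exact vh_convex (by linarith) hb (by linarith) hd
  have hk1 : ContinuousOn e I := by rw [he, hI]; exact vh_line_cont hb hd
  have hk2 : ContinuousOn eμ I := by rw [heμ, hI]; exact vh_line_cont hb hd
  have hOC : I.OrdConnected := by rw [hI]; exact Set.ordConnected_Ioo
  have hanti : ∀ u ∈ I, ∀ v ∈ I, u < v → eμ v - e v < eμ u - e u := by
    intro u hu v hv huv
    rw [hI] at hu hv
    simp only [he, heμ, vh_diff]
    have hv2 := (lt_div_iff₀ hd).1 hv.2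
    have k1 := Real.log_lt_log hu.1 huv
    have k2 : Real.log ((a + c - d * v) / b) < Real.log ((a + c - d * u) / b) := by
      apply Real.log_lt_log
      · apply div_pos _ hb; linarith
      · apply div_lt_div_of_pos_right _ hb
        nlinarith
    apply mul_lt_mul_of_pos_left _ hμ
    linarith
  by_contra! hcon
  have hcon2 : q < eμ x := by linarith
  rcases lt_or_ge x p1m with hx1 | hx1
  · obtain ⟨w, hw, hwe⟩ := intermediate_value_Icc' hx1.le (hk1.mono (hOC.out hx i1))
      (show p ∈ Set.Icc (e p1m) (e x) from ⟨by rw [v1]; exact hp.1, hcon.le⟩)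
    have hwI := hOC.out hx i1 hw
    have hne : x < w := lt_of_le_of_ne hw.1 (by rintro rfl; linarith)
    have := hanti x hx w hwI hne
    have hge : h2 ≤ eμ w := by
      by_contra! hlt
      have := hc2.le_max_of_mem_Icc hwI i4 (⟨hw.2.trans o1, o2.le⟩ : q2m ∈ Set.Icc w q1m)
      rw [v5, v4] at this
      rcases le_max_iff.1 this with h | h <;> linarith
    linarith [hq.2]
  · rcases le_or_gt x p1p with hx2 | hx2
    · have := hc1.le_max_of_mem_Icc i1 i2 (⟨hx1, hx2⟩ : x ∈ Set.Icc p1m p1p)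
      rw [v1, v2, max_self] at this
      linarith [hp.1]
    · rcases le_or_gt x q1p with hx3 | hx3
      · have := hc2.le_max_of_mem_Icc i4 i6 (⟨by linarith, hx3⟩ : x ∈ Set.Icc q1m q1p)
        rw [v4, v6, max_self] at this
        linarith [hq.1]
      · obtain ⟨w, hw, hwe⟩ := intermediate_value_Icc hx3.le (hk2.mono (hOC.out i6 hx))
          (show q ∈ Set.Icc (eμ q1p) (eμ x) from ⟨by rw [v6]; exact hq.1, hcon2.le⟩)
        have hwI := hOC.out i6 hx hw
        have hne : w < x := lt_of_le_of_ne hw.2 (by rintro rfl; linarith)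
        have := hanti w hwI x hx hne
        have hge : l2 ≤ e w := by
          by_contra! hlt
          have := hc1.le_max_of_mem_Icc i2 hwI (⟨o4.le, o5.trans hw.1⟩ : p2p ∈ Set.Icc p1p w)
          rw [v3, v2] at this
          rcases le_max_iff.1 this with h | h <;> linarith
        linarith [hp.2]

/-- base point of the ray with ratio `exp ((q-p)/μ)` -/
noncomputable def vhs (a b c d μ : ℝ) (w : ℝ × ℝ) : ℝ :=
  (a + c) / (d + b * Real.exp ((w.2 - w.1) / μ))

/-- the parametrization -/
noncomputable def vhZx (a b c d μ σ : ℝ) (w : ℝ × ℝ) : ℝ :=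
  vhs a b c d μ w * Real.exp (vhU (σ * √((w.1 - vhE a b c d (vhs a b c d μ w,
    Real.exp ((w.2 - w.1) / μ) * vhs a b c d μ w)) / (a + c))))

/-- the parametrization -/
noncomputable def vhZ (a b c d μ σ : ℝ) (w : ℝ × ℝ) : ℝ × ℝ :=
  (vhZx a b c d μ σ w, Real.exp ((w.2 - w.1) / μ) * vhZx a b c d μ σ w)

theorem vhs_pos {a b c d : ℝ} (μ : ℝ)
    (ha : 0 < a) (hb : 0 < b) (hc : 0 < c) (hd : 0 < d) (w : ℝ × ℝ) : 0 < vhs a b c d μ w := by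
  unfold vhs; positivity

theorem vhs_continuous {a b c d : ℝ} (μ : ℝ) (hb : 0 < b) (hd : 0 < d) :
    Continuous (vhs a b c d μ) := by
  unfold vhs
  refine Continuous.div (by fun_prop) (by fun_prop) fun w => ?_
  positivity

theorem vhZ_continuous {a b c d : ℝ} (μ σ : ℝ)
    (ha : 0 < a) (hb : 0 < b) (hc : 0 < c) (hd : 0 < d) : Continuous (vhZ a b c d μ σ) := by
  have hs := vhs_continuous (a := a) (c := c) μ hb hd
  have hpt : Continuous fun w : ℝ × ℝ => (vhs a b c d μ w,
    Real.exp ((w.2 - w.1) / μ) * vhs a b c d μ w) := by fun_prop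
  have hE : Continuous fun w : ℝ × ℝ => vhE a b c d (vhs a b c d μ w,
    Real.exp ((w.2 - w.1) / μ) * vhs a b c d μ w) := by
    refine (vhE_continuousOn a b c d).comp_continuous hpt fun w => ?_
    have := vhs_pos μ ha hb hc hd w
    exact ⟨this, mul_pos (Real.exp_pos _) this⟩
  have hU := vhU_continuous
  have hZx : Continuous (vhZx a b c d μ σ) := by
    unfold vhZx
    fun_prop
  unfold vhZ
  fun_prop

theorem vhZx_pos {a b c d : ℝ} (μ σ : ℝ)
    (ha : 0 < a) (hb : 0 < b) (hc : 0 < c) (hd : 0 < d) (w : ℝ × ℝ) :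
    0 < vhZx a b c d μ σ w :=
  mul_pos (vhs_pos μ ha hb hc hd w) (Real.exp_pos _)

theorem vhZ_spec {a b c d μ σ : ℝ}
    (ha : 0 < a) (hb : 0 < b) (hc : 0 < c) (hd : 0 < d) (hμ : 0 < μ) (hσ : σ = 1 ∨ σ = -1)
    (w : ℝ × ℝ) (hw : vhE a b c d (vhs a b c d μ w,
      Real.exp ((w.2 - w.1) / μ) * vhs a b c d μ w) ≤ w.1) :
    vhE a b c d (vhZ a b c d μ σ w) = w.1 ∧ vhE (a - μ) b (c + μ) d (vhZ a b c d μ σ w) = w.2 ∧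
      0 ≤ σ * (d * (vhZ a b c d μ σ w).1 + b * (vhZ a b c d μ σ w).2 - (a + c)) := by
  have hsp := vhs_pos μ ha hb hc hd w
  have hzp := vhZx_pos μ σ ha hb hc hd w
  set κ := Real.exp ((w.2 - w.1) / μ) with hκ
  have hκp : 0 < κ := Real.exp_pos _
  have hlκ : Real.log κ = (w.2 - w.1) / μ := Real.log_exp _
  set s := vhs a b c d μ w with hs
  have hsK : (d + b * κ) * s = a + c := by
    rw [hs, vhs, ← hκ]
    field_simp
  set u := vhU (σ * √((w.1 - vhE a b c d (s, κ * s)) / (a + c))) with hu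
  have hx : vhZx a b c d μ σ w = s * Real.exp u := rfl
  have hσ2 : σ ^ 2 = 1 := by rcases hσ with h | h <;> rw [h] <;> norm_num
  have hΦ : (a + c) * (Real.exp u - u - 1) = w.1 - vhE a b c d (s, κ * s) := by
    rw [← vhPhi_sq, hu, vhPhi_U, mul_pow, hσ2, Real.sq_sqrt]
    · field_simp
    · apply div_nonneg <;> linarith
  have hE0 : vhE a b c d (vhZ a b c d μ σ w) = w.1 := by
    simp only [vhE] at hΦ
    simp only [vhE, vhZ, ← hκ]
    rw [hx, Real.log_mul hκp.ne' (by positivity), Real.log_mul hsp.ne' (Real.exp_pos u).ne',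
      Real.log_exp]
    rw [Real.log_mul hκp.ne' hsp.ne'] at hΦ
    linear_combination hΦ + (Real.exp u - 1) * hsK
  refine ⟨hE0, ?_, ?_⟩
  · have h1 := vh_diff a b c d μ (vhZ a b c d μ σ w)
    rw [hE0] at h1
    simp only [vhZ, ← hκ] at h1 ⊢
    rw [Real.log_mul hκp.ne' hzp.ne', hlκ] at h1
    have h2 : μ * ((w.2 - w.1) / μ) = w.2 - w.1 := by field_simp
    linear_combination h1 + h2
  · have h1 : d * (vhZ a b c d μ σ w).1 + b * (vhZ a b c d μ σ w).2 - (a + c) =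
        (a + c) * (Real.exp u - 1) := by
      simp only [vhZ, ← hκ]
      rw [hx]
      linear_combination Real.exp u * hsK
    rw [h1]
    rcases hσ with h | h
    · have : 0 ≤ u := by
        apply vhU_nonneg; rw [h, one_mul]; positivity
      have := Real.one_le_exp this
      rw [h, one_mul]
      apply mul_nonneg <;> linarith
    · have : u ≤ 0 := by
        apply vhU_nonpos; rw [h]; linarith [Real.sqrt_nonneg ((w.1 - vhE a b c d (s, κ * s)) / (a + c))]
      have := Real.exp_le_one_iff.2 this
      rw [h]
      nlinarith

theorem vh_choose (T₁ T₂ : ℝ) (h1 : 0 < T₁) (h2 : T₁ < T₂) (m : ℕ) : ∃ α : ℝ, 0 < α ∧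
    ∀ r, α < r → ∃ n : ℤ, ∀ j : ℕ, j < m →
      T₁ + ((n + j : ℤ) : ℝ) * T₁ < r ∧ r < ((n + j : ℤ) : ℝ) * T₂ - T₂ := by
  have hT : 0 < T₂ - T₁ := by linarith
  have h3 : 0 < T₂ := by linarith
  refine ⟨(m + 2) * T₁ * T₂ / (T₂ - T₁), by positivity, fun r hr => ⟨⌊r / T₂⌋ + 2, fun j hj => ?_⟩⟩
  have f1 := Int.floor_le (r / T₂)
  have f2 := Int.lt_floor_add_one (r / T₂)
  rw [div_lt_iff₀ hT] at hr
  rw [le_div_iff₀ h3] at f1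
  rw [div_lt_iff₀ h3] at f2
  have hj' : (j : ℝ) + 1 ≤ m := by exact_mod_cast hj
  have hj0 : (0:ℝ) ≤ j := Nat.cast_nonneg j
  push_cast
  generalize (⌊r / T₂⌋ : ℝ) = N at *
  generalize (j : ℝ) = J at *
  generalize (m : ℝ) = M at *
  constructor
  · have k1 : N * T₂ * T₁ ≤ r * T₁ := mul_le_mul_of_nonneg_right f1 h1.le
    have k2 : (J + 1) * (T₁ * T₂) ≤ M * (T₁ * T₂) :=
      mul_le_mul_of_nonneg_right hj' (by positivity)
    have : (T₁ + (N + 2 + J) * T₁) * T₂ < r * T₂ := by nlinarith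
    exact lt_of_mul_lt_mul_right this h3.le
  · have : 0 ≤ J * T₂ := by positivity
    nlinarith

theorem vh_side {a b c d μ σ : ℝ}
    (ha : 0 < a) (hb : 0 < b) (hc : 0 < c) (hd : 0 < d) (hμ : 0 < μ) (hμa : μ < a)
    (hσ : σ = 1 ∨ σ = -1) {l1 l2 h1 h2 : ℝ}
    (hl1 : vhE a b c d (c / d, a / b) < l1) (hl : l1 < l2)
    (hh1 : vhE (a - μ) b (c + μ) d ((c + μ) / d, (a - μ) / b) < h1) (hh : h1 < h2)
    (hbase : ∀ p ∈ Set.Icc l1 l2, ∀ q ∈ Set.Icc h1 h2, vhE a b c d (vhs a b c d μ (p, q),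
      Real.exp ((q - p) / μ) * vhs a b c d μ (p, q)) ≤ p)
    (m : ℕ) (r₀ rμ : ℝ) (hr₀ : 0 ≤ r₀) (hrμ : 0 ≤ rμ) (n n' : ℤ)
    (hn : ∀ j : ℕ, j < m →
      vhTE a b c d l1 + ((n + j : ℤ) : ℝ) * vhTE a b c d l1 < r₀ ∧
        r₀ < ((n + j : ℤ) : ℝ) * vhTE a b c d l2 - vhTE a b c d l2)
    (hn' : vhTE (a - μ) b (c + μ) d h1 + (n' : ℝ) * vhTE (a - μ) b (c + μ) d h1 < rμ ∧
        rμ < (n' : ℝ) * vhTE (a - μ) b (c + μ) d h2 - vhTE (a - μ) b (c + μ) d h2)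
    (φ₀ φμ : ℝ × ℝ → ℝ × ℝ)
    (hφ₀ : ∀ z ∈ Set.Ioi (0:ℝ) ×ˢ Set.Ioi (0:ℝ), ∃ ζ : ℝ → ℝ × ℝ, ζ 0 = z ∧
      (∀ t ∈ Set.Icc (0 : ℝ) r₀, ζ t ∈ Set.Ioi (0:ℝ) ×ˢ Set.Ioi (0:ℝ)) ∧
      (∀ t ∈ Set.Icc (0 : ℝ) r₀, HasDerivWithinAt ζ
        ((ζ t).1 * (a - b * (ζ t).2), (ζ t).2 * (-c + d * (ζ t).1))
        (Set.Icc (0 : ℝ) r₀) t) ∧ ζ r₀ = φ₀ z)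
    (hφμ : ∀ z ∈ Set.Ioi (0:ℝ) ×ˢ Set.Ioi (0:ℝ), ∃ ζ : ℝ → ℝ × ℝ, ζ 0 = z ∧
      (∀ t ∈ Set.Icc (0 : ℝ) rμ, ζ t ∈ Set.Ioi (0:ℝ) ×ˢ Set.Ioi (0:ℝ)) ∧
      (∀ t ∈ Set.Icc (0 : ℝ) rμ, HasDerivWithinAt ζ
        ((ζ t).1 * ((a - μ) - b * (ζ t).2), (ζ t).2 * (-(c + μ) + d * (ζ t).1))
        (Set.Icc (0 : ℝ) rμ) t) ∧ ζ rμ = φμ z)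
    (R : Set (ℝ × ℝ))
    (hR : ∀ z : ℝ × ℝ, 0 < z.1 → 0 < z.2 → vhE a b c d z ∈ Set.Icc l1 l2 →
      vhE (a - μ) b (c + μ) d z ∈ Set.Icc h1 h2 →
      0 ≤ σ * (d * z.1 + b * z.2 - (a + c)) → z ∈ R) :
    InducesChaoticDynamics (φμ ∘ φ₀) R m := by
  have haμ : 0 < a - μ := by linarith
  have hcμ : 0 < c + μ := by linarith
  set Z := vhZ a b c d μ σ with hZdef
  have hZc : Continuous Z := vhZ_continuous μ σ ha hb hc hd
  have hZp : ∀ w, 0 < (Z w).1 ∧ 0 < (Z w).2 := fun w =>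
    ⟨vhZx_pos μ σ ha hb hc hd w, mul_pos (Real.exp_pos _) (vhZx_pos μ σ ha hb hc hd w)⟩
  have hspec : ∀ p ∈ Set.Icc l1 l2, ∀ q ∈ Set.Icc h1 h2, vhE a b c d (Z (p, q)) = p ∧
      vhE (a - μ) b (c + μ) d (Z (p, q)) = q ∧
      0 ≤ σ * (d * (Z (p, q)).1 + b * (Z (p, q)).2 - (a + c)) := fun p hp q hq =>
    vhZ_spec ha hb hc hd hμ hσ (p, q) (hbase p hp q hq)
  have hD0 : ∀ p ∈ Set.Icc l1 l2, ∀ q ∈ Set.Icc h1 h2, Z (p, q) ∈ vhD a b c d σ := by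
    intro p hp q hq
    obtain ⟨e1, e2, e3⟩ := hspec p hp q hq
    refine ⟨(hZp _).1, (hZp _).2, e3, ?_⟩
    rw [e1]
    linarith [hp.1]
  have hDμ : ∀ p ∈ Set.Icc l1 l2, ∀ q ∈ Set.Icc h1 h2, Z (p, q) ∈ vhD (a - μ) b (c + μ) d σ := by
    intro p hp q hq
    obtain ⟨e1, e2, e3⟩ := hspec p hp q hq
    refine ⟨(hZp _).1, (hZp _).2, ?_, ?_⟩
    · rwa [show a - μ + (c + μ) = a + c by ring]
    · rw [e2]
      linarith [hq.1]
  have hA0 := vhA_continuousOn ha hb hc hd hσ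
  have hAμ := vhA_continuousOn haμ hb hcμ hd hσ
  have l1m : l1 ∈ Set.Icc l1 l2 := ⟨le_rfl, hl.le⟩
  have l2m : l2 ∈ Set.Icc l1 l2 := ⟨hl.le, le_rfl⟩
  have h1m : h1 ∈ Set.Icc h1 h2 := ⟨le_rfl, hh.le⟩
  have h2m : h2 ∈ Set.Icc h1 h2 := ⟨hh.le, le_rfl⟩
  have hlt0 : ∀ p ∈ Set.Icc l1 l2, ∀ q ∈ Set.Icc h1 h2, ∀ q' ∈ Set.Icc h1 h2,
      vhA a b c d σ (Z (p, q')) - vhA a b c d σ (Z (p, q)) < vhTE a b c d p := by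
    intro p hp q hq q' hq'
    have := vhA_lt (σ := σ) (b := b) (d := d) ha hc (z := Z (p, q)) (z' := Z (p, q'))
      (by rw [(hspec p hp q hq).1, (hspec p hp q' hq').1])
    rwa [(hspec p hp q hq).1] at this
  have hltμ : ∀ q ∈ Set.Icc h1 h2, ∀ p ∈ Set.Icc l1 l2, ∀ p' ∈ Set.Icc l1 l2,
      vhA (a - μ) b (c + μ) d σ (Z (p', q)) - vhA (a - μ) b (c + μ) d σ (Z (p, q)) <
        vhTE (a - μ) b (c + μ) d q := by
    intro q hq p hp p' hp'
    have := vhA_lt (σ := σ) (b := b) (d := d) haμ hcμ (z := Z (p, q)) (z' := Z (p', q))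
      (by rw [(hspec p hp q hq).2.1, (hspec p' hp' q hq).2.1])
    rwa [(hspec p hp q hq).2.1] at this
  refine vh_chaos hl.le hh.le
    (fun j x => vhA a b c d σ (Z (x.1, x.2.2)) - vhA a b c d σ (Z (x.1, x.2.1)) +
      ((n + (j : ℕ) : ℤ) : ℝ) * vhTE a b c d x.1 - r₀)
    (fun x => vhA (a - μ) b (c + μ) d σ (Z (x.2.2, x.1)) -
      vhA (a - μ) b (c + μ) d σ (Z (x.2.1, x.1)) +
      (n' : ℝ) * vhTE (a - μ) b (c + μ) d x.1 - rμ)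
    ?_ ?_ ?_ ?_ ?_ ?_ Z hZc.continuousOn ?_ R ?_ φ₀ φμ ?_ ?_ ?_
  · intro j
    refine ContinuousOn.sub (ContinuousOn.add (ContinuousOn.sub ?_ ?_) ?_) continuousOn_const
    · exact hA0.comp (hZc.comp (by fun_prop :
        Continuous fun x : ℝ × ℝ × ℝ => (x.1, x.2.2))).continuousOn
        fun x hx => hD0 _ hx.1 _ hx.2.2
    · exact hA0.comp (hZc.comp (by fun_prop :
        Continuous fun x : ℝ × ℝ × ℝ => (x.1, x.2.1))).continuousOn
        fun x hx => hD0 _ hx.1 _ hx.2.1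
    · exact continuousOn_const.mul ((vhTE_continuous a b c d).comp continuous_fst).continuousOn
  · refine ContinuousOn.sub (ContinuousOn.add (ContinuousOn.sub ?_ ?_) ?_) continuousOn_const
    · exact hAμ.comp (hZc.comp (by fun_prop :
        Continuous fun x : ℝ × ℝ × ℝ => (x.2.2, x.1))).continuousOn
        fun x hx => hDμ _ hx.2.2 _ hx.1
    · exact hAμ.comp (hZc.comp (by fun_prop :
        Continuous fun x : ℝ × ℝ × ℝ => (x.2.1, x.1))).continuousOn
        fun x hx => hDμ _ hx.2.1 _ hx.1
    · exact continuousOn_const.mul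
        ((vhTE_continuous (a - μ) b (c + μ) d).comp continuous_fst).continuousOn
  · intro j q hq q' hq'
    have k1 := hlt0 l1 l1m q hq q' hq'
    have k2 := (hn j j.2).1
    dsimp only
    linarith
  · intro j q hq q' hq'
    have k1 := hlt0 l2 l2m q' hq' q hq
    have k2 := (hn j j.2).2
    dsimp only
    linarith
  · intro p hp p' hp'
    have k1 := hltμ h1 h1m p hp p' hp'
    have k2 := hn'.1
    dsimp only
    linarith
  · intro p hp p' hp'
    have k1 := hltμ h2 h2m p' hp' p hp
    have k2 := hn'.2
    dsimp only
    linarith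
  · rintro ⟨p, q⟩ ⟨hp, hq⟩ ⟨p', q'⟩ ⟨hp', hq'⟩ heq
    obtain ⟨e1, e2, -⟩ := hspec p hp q hq
    obtain ⟨e3, e4, -⟩ := hspec p' hp' q' hq'
    rw [heq] at e1 e2
    rw [← e1, ← e2, e3, e4]
  · intro p hp q hq
    obtain ⟨e1, e2, e3⟩ := hspec p hp q hq
    refine hR _ (hZp _).1 (hZp _).2 ?_ ?_ e3
    · rw [e1]; exact hp
    · rw [e2]; exact hq
  · intro j p hp q hq q' hq' h0
    obtain ⟨ζ, z0, z1, z2, z3⟩ := hφ₀ (Z (p, q)) ⟨(hZp _).1, (hZp _).2⟩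
    rw [← z3]
    dsimp only at h0
    refine vhA_flow ha hb hc hd hσ hr₀ ζ (fun t ht => ⟨(z1 t ht).1, (z1 t ht).2⟩) z2
      (hD0 p hp q' hq') ?_ (n + (j : ℕ)) ?_
    · rw [z0, (hspec p hp q hq).1, (hspec p hp q' hq').1]
    · rw [z0, (hspec p hp q' hq').1]
      linarith
  · intro q hq p hp p' hp' h0
    obtain ⟨ζ, z0, z1, z2, z3⟩ := hφμ (Z (p, q)) ⟨(hZp _).1, (hZp _).2⟩
    rw [← z3]
    dsimp only at h0
    refine vhA_flow haμ hb hcμ hd hσ hrμ ζ (fun t ht => ⟨(z1 t ht).1, (z1 t ht).2⟩) z2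
      (hDμ p' hp' q hq) ?_ n' ?_
    · rw [z0, (hspec p hp q hq).2.1, (hspec p' hp' q hq).2.1]
    · rw [z0, (hspec p' hp' q hq).2.1]
      linarith
  · intro i j p hp q hq q' hq' h0 h0'
    dsimp only at h0 h0'
    have hT := vhTE_pos (b := b) (d := d) ha hc p
    have h3 : ((n + (i : ℕ) : ℤ) : ℝ) = ((n + (j : ℕ) : ℤ) : ℝ) :=
      mul_right_cancel₀ hT.ne' (by linarith)
    have h4 : (n + (i : ℕ) : ℤ) = (n + (j : ℕ) : ℤ) := by exact_mod_cast h3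
    exact Fin.ext (by omega)

/-- Theorem 1.2: chaotic dynamics for the periodically harvested Volterra
predator–prey system `(E*)`. Given constants `a, b, c, d > 0`, `0 < μ < a`, energies
`E₀`, `E_μ` of the unharvested/harvested systems, and two linked annuli
`A_P = {ℓ₁ ≤ E₀ ≤ ℓ₂}`, `A_Q = {h₁ ≤ E_μ ≤ h₂}` (linking expressed by the order of the
intersection points of the boundary level lines with the line `r` through the two
centers), with intersection rectangles `R₁` (below `r`) and `R₂` (above `r`): for every
`m ≥ 2` there are `α, β > 0` such that for all switching times `r₀ > α`, `r_μ > β`, the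
Poincaré map `φ = φ_μ ∘ φ₀` (where `φ₀`, `φ_μ` are the time-`r₀`, time-`r_μ` maps of the
two autonomous systems on the open quadrant) induces chaotic dynamics on `m` symbols
both in `R₁` and in `R₂`. -/
theorem volterra_harvesting_chaos (a b c d μ : ℝ)
    (ha : 0 < a) (hb : 0 < b) (hc : 0 < c) (hd : 0 < d)
    (hμ : 0 < μ) (hμa : μ < a)
    (E₀ Eμ : ℝ × ℝ → ℝ)
    (hE₀ : ∀ z : ℝ × ℝ,
      E₀ z = d * z.1 - c * Real.log z.1 + b * z.2 - a * Real.log z.2)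
    (hEμ : ∀ z : ℝ × ℝ,
      Eμ z = d * z.1 - (c + μ) * Real.log z.1 + b * z.2 - (a - μ) * Real.log z.2)
    (ℓ₁ ℓ₂ h₁ h₂ : ℝ)
    (hℓ₁ : E₀ (c / d, a / b) < ℓ₁) (hℓ : ℓ₁ < ℓ₂)
    (hh₁ : Eμ ((c + μ) / d, (a - μ) / b) < h₁) (hh : h₁ < h₂)
    (Quad : Set (ℝ × ℝ)) (hQuad : Quad = Set.Ioi (0 : ℝ) ×ˢ Set.Ioi (0 : ℝ))
    (AP AQ : Set (ℝ × ℝ))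
    (hAP : AP = {z ∈ Quad | ℓ₁ ≤ E₀ z ∧ E₀ z ≤ ℓ₂})
    (hAQ : AQ = {z ∈ Quad | h₁ ≤ Eμ z ∧ Eμ z ≤ h₂})
    (r : Set (ℝ × ℝ)) (hr : r = {z ∈ Quad | d * z.1 + b * z.2 = a + c})
    -- the linking condition: the boundary level lines meet the line `r` in exactly two
    -- points each, ordered (by their first coordinate) as prescribed
    (P1m P1p P2m P2p Q1m Q1p Q2m Q2p : ℝ × ℝ)
    (hΓ₁ : {z ∈ Quad | E₀ z = ℓ₁} ∩ r = {P1m, P1p})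
    (hΓ₂ : {z ∈ Quad | E₀ z = ℓ₂} ∩ r = {P2m, P2p})
    (hΓμ₁ : {z ∈ Quad | Eμ z = h₁} ∩ r = {Q1m, Q1p})
    (hΓμ₂ : {z ∈ Quad | Eμ z = h₂} ∩ r = {Q2m, Q2p})
    (hlink : P2m.1 < P1m.1 ∧ P1m.1 ≤ Q2m.1 ∧ Q2m.1 < Q1m.1 ∧ Q1m.1 ≤ P1p.1 ∧
      P1p.1 < P2p.1 ∧ P2p.1 ≤ Q1p.1 ∧ Q1p.1 < Q2p.1)
    (R₁ R₂ : Set (ℝ × ℝ))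
    (hR₁ : R₁ = AP ∩ AQ ∩ {z : ℝ × ℝ | d * z.1 + b * z.2 ≤ a + c})
    (hR₂ : R₂ = AP ∩ AQ ∩ {z : ℝ × ℝ | a + c ≤ d * z.1 + b * z.2}) :
    ∀ m : ℕ, 2 ≤ m → ∃ α β : ℝ, 0 < α ∧ 0 < β ∧
      ∀ r₀ rμ : ℝ, α < r₀ → β < rμ →
        ∀ φ₀ φμ : ℝ × ℝ → ℝ × ℝ,
          -- `φ₀` is the Poincaré map of the unharvested system on `[0, r₀]`
          (∀ z ∈ Quad, ∃ ζ : ℝ → ℝ × ℝ, ζ 0 = z ∧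
            (∀ t ∈ Set.Icc (0 : ℝ) r₀, ζ t ∈ Quad) ∧
            (∀ t ∈ Set.Icc (0 : ℝ) r₀, HasDerivWithinAt ζ
              ((ζ t).1 * (a - b * (ζ t).2), (ζ t).2 * (-c + d * (ζ t).1))
              (Set.Icc (0 : ℝ) r₀) t) ∧
            ζ r₀ = φ₀ z) →
          -- `φ_μ` is the Poincaré map of the harvested system on `[0, r_μ]`
          (∀ z ∈ Quad, ∃ ζ : ℝ → ℝ × ℝ, ζ 0 = z ∧
            (∀ t ∈ Set.Icc (0 : ℝ) rμ, ζ t ∈ Quad) ∧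
            (∀ t ∈ Set.Icc (0 : ℝ) rμ, HasDerivWithinAt ζ
              ((ζ t).1 * ((a - μ) - b * (ζ t).2), (ζ t).2 * (-(c + μ) + d * (ζ t).1))
              (Set.Icc (0 : ℝ) rμ) t) ∧
            ζ rμ = φμ z) →
          InducesChaoticDynamics (φμ ∘ φ₀) R₁ m ∧
          InducesChaoticDynamics (φμ ∘ φ₀) R₂ m := by
  intro m hm
  obtain rfl : E₀ = vhE a b c d := funext fun z => hE₀ z
  obtain rfl : Eμ = vhE (a - μ) b (c + μ) d := funext fun z => hEμ z
  have haμ : 0 < a - μ := by linarith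
  have hcμ : 0 < c + μ := by linarith
  have hmem : ∀ (F : ℝ × ℝ → ℝ) (l : ℝ) (P P' : ℝ × ℝ),
      {z ∈ Quad | F z = l} ∩ r = {P, P'} →
      ∀ z, (z = P ∨ z = P') → z.1 ∈ Set.Ioo 0 ((a + c) / d) ∧
        F (z.1, (a + c - d * z.1) / b) = l := by
    intro F l P P' hF z hz
    have hz' : z ∈ {z ∈ Quad | F z = l} ∩ r := by
      rw [hF]
      exact hz
    rw [hr, hQuad] at hz'
    obtain ⟨⟨⟨h1, h2⟩, h3⟩, -, h4⟩ := hz'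
    have h1 : 0 < z.1 := h1
    have h2 : 0 < z.2 := h2
    have h5 : (a + c - d * z.1) / b = z.2 := by
      rw [div_eq_iff hb.ne', ← h4]
      ring
    refine ⟨⟨h1, ?_⟩, ?_⟩
    · rw [lt_div_iff₀ hd, ← h4]
      have : 0 < b * z.2 := by positivity
      linarith
    · rw [h5]
      exact h3
  obtain ⟨i1, v1⟩ := hmem _ _ _ _ hΓ₁ P1m (Or.inl rfl)
  obtain ⟨i2, v2⟩ := hmem _ _ _ _ hΓ₁ P1p (Or.inr rfl)
  obtain ⟨i3, v3⟩ := hmem _ _ _ _ hΓ₂ P2p (Or.inr rfl)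
  obtain ⟨i4, v4⟩ := hmem _ _ _ _ hΓμ₁ Q1m (Or.inl rfl)
  obtain ⟨i5, v5⟩ := hmem _ _ _ _ hΓμ₂ Q2m (Or.inl rfl)
  obtain ⟨i6, v6⟩ := hmem _ _ _ _ hΓμ₁ Q1p (Or.inr rfl)
  obtain ⟨-, o1, o2, o3, o4, o5, -⟩ := hlink
  have hbase : ∀ p ∈ Set.Icc ℓ₁ ℓ₂, ∀ q ∈ Set.Icc h₁ h₂, vhE a b c d (vhs a b c d μ (p, q),
      Real.exp ((q - p) / μ) * vhs a b c d μ (p, q)) ≤ p := by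
    intro p hp q hq
    have hs := vhs_pos μ ha hb hc hd (p, q)
    have hκ := Real.exp_pos ((q - p) / μ)
    have hsK : (d + b * Real.exp ((q - p) / μ)) * vhs a b c d μ (p, q) = a + c := by
      rw [vhs]
      field_simp
    have hy : Real.exp ((q - p) / μ) * vhs a b c d μ (p, q) =
        (a + c - d * vhs a b c d μ (p, q)) / b := by
      rw [eq_div_iff hb.ne', ← hsK]
      ring
    have hdiff := vh_diff a b c d μ (vhs a b c d μ (p, q),
      Real.exp ((q - p) / μ) * vhs a b c d μ (p, q))
    rw [Real.log_mul hκ.ne' hs.ne', Real.log_exp,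
      show μ * ((q - p) / μ + Real.log (vhs a b c d μ (p, q)) -
        Real.log (vhs a b c d μ (p, q))) = q - p by field_simp; ring] at hdiff
    rw [hy] at hdiff ⊢
    refine vh_key (x := vhs a b c d μ (p, q))
      (e := fun x => vhE a b c d (x, (a + c - d * x) / b))
      (eμ := fun x => vhE (a - μ) b (c + μ) d (x, (a + c - d * x) / b)) ha hb hc hd hμ hμa rfl rfl rfl i1 i2 i4 i6 v1 v2 v3 v4 v5 v6 hℓ hh
      o1 o2 o3 o4 o5 hp hq ⟨hs, ?_⟩ hdiff
    rw [lt_div_iff₀ hd, ← hsK]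
    have : 0 < b * Real.exp ((q - p) / μ) * vhs a b c d μ (p, q) := by positivity
    linarith
  obtain ⟨α, hα, hα'⟩ := vh_choose _ _ (vhTE_pos (b := b) (d := d) ha hc ℓ₁)
    (vhTE_lt ha hc hℓ₁ hℓ) m
  obtain ⟨β, hβ, hβ'⟩ := vh_choose _ _ (vhTE_pos (b := b) (d := d) haμ hcμ h₁)
    (vhTE_lt haμ hcμ hh₁ hh) 1
  refine ⟨α, β, hα, hβ, fun r₀ rμ hr₀ hrμ φ₀ φμ hφ₀ hφμ => ?_⟩
  obtain ⟨n, hn⟩ := hα' r₀ hr₀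
  obtain ⟨n', hn'⟩ := hβ' rμ hrμ
  have hn'' := hn' 0 (by norm_num)
  simp only [Nat.cast_zero, add_zero] at hn''
  rw [hQuad] at hφ₀ hφμ
  constructor
  · refine vh_side ha hb hc hd hμ hμa (Or.inr rfl : (-1 : ℝ) = 1 ∨ (-1 : ℝ) = -1) hℓ₁ hℓ hh₁ hh
      hbase m r₀ rμ (by linarith) (by linarith) n n' hn hn'' φ₀ φμ hφ₀ hφμ R₁ ?_
    intro z z1 z2 e1 e2 hs
    rw [hR₁, hAP, hAQ, hQuad]
    refine ⟨⟨⟨⟨z1, z2⟩, e1⟩, ⟨⟨z1, z2⟩, e2⟩⟩, ?_⟩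
    change d * z.1 + b * z.2 ≤ a + c
    linarith
  · refine vh_side ha hb hc hd hμ hμa (Or.inl rfl : (1 : ℝ) = 1 ∨ (1 : ℝ) = -1) hℓ₁ hℓ hh₁ hh
      hbase m r₀ rμ (by linarith) (by linarith) n n' hn hn'' φ₀ φμ hφ₀ hφμ R₂ ?_
    intro z z1 z2 e1 e2 hs
    rw [hR₂, hAP, hAQ, hQuad]
    refine ⟨⟨⟨⟨z1, z2⟩, e1⟩, ⟨⟨z1, z2⟩, e2⟩⟩, ?_⟩
    change a + c ≤ d * z.1 + b * z.2
    linarith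
end

section
/- Let T > 0 and let a, b, c, d : ℝ → ℝ be continuous T-periodic functions with b(t) > 0 and d(t) > 0 for all t ∈ [0,T], and with mean values (1/T)∫_0^T a(t) dt > 0 and (1/T)∫_0^T c(t) dt > 0. Then the planar system (E): x' = x(a(t) − b(t) y), y' = y(−c(t) + d(t) x) has at least one positive T-periodic solution, i.e. there exist C¹ functions x, y : ℝ → ℝ with x(t) > 0, y(t) > 0, x(t+T) = x(t), y(t+T) = y(t) for all t, and x'(t) = x(t)(a(t) − b(t) y(t)), y'(t) = y(t)(−c(t) + d(t) x(t)) for all t ∈ ℝ. -/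
open Set Filter Topology MeasureTheory

lemma seg_stay (φ : ℝ → ℝ) (hφ : Continuous φ) (α β s₀ s₁ : ℝ)
    (hα : ∀ s ∈ uIcc s₀ s₁, φ s ≠ α) (hβ : ∀ s ∈ uIcc s₀ s₁, φ s ≠ β)
    (h0 : α < φ s₀ ∧ φ s₀ < β) : α < φ s₁ ∧ φ s₁ < β := by
  have key := intermediate_value_uIcc (hφ.continuousOn (s := uIcc s₀ s₁))
  constructor
  · by_contra h
    push Not at h
    obtain ⟨s, hs, e⟩ := key (mem_uIcc.2 (Or.inr ⟨h, h0.1.le⟩))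
    exact hα s hs e
  · by_contra h
    push Not at h
    obtain ⟨s, hs, e⟩ := key (mem_uIcc.2 (Or.inl ⟨h0.2.le, h⟩))
    exact hβ s hs e

/-- A planar Poincaré–Miranda theorem. -/
lemma miranda (X Y : ℝ × ℝ → ℝ) (hX : Continuous X) (hY : Continuous Y) (R : ℝ)
    (h1 : ∀ p : ℝ × ℝ, R ≤ p.1 → 0 < X p) (h2 : ∀ p : ℝ × ℝ, p.1 ≤ -R → X p < 0)
    (h3 : ∀ p : ℝ × ℝ, R ≤ p.2 → 0 < Y p) (h4 : ∀ p : ℝ × ℝ, p.2 ≤ -R → Y p < 0) :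
    ∃ p, X p = 0 ∧ Y p = 0 := by
  by_contra hno
  push Not at hno
  let f : C(ℝ × ℝ, ℂ) := ⟨fun p => ⟨X p, Y p⟩, by
    have : (fun p => (⟨X p, Y p⟩ : ℂ)) = fun p => (X p : ℂ) + (Y p : ℂ) * Complex.I := by
      funext p; exact (Complex.mk_eq_add_mul_I _ _)
    rw [this]; fun_prop⟩
  have hf0 : ∀ p, f p ∈ ({0}ᶜ : Set ℂ) := by
    intro p h
    have h' : (⟨X p, Y p⟩ : ℂ) = 0 := h
    have e1 := congrArg Complex.re h'
    have e2 := congrArg Complex.im h'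
    exact hno p e1 e2
  obtain ⟨F, ⟨hF0, hF⟩, -⟩ := Complex.isCoveringMapOn_exp.existsUnique_continuousMap_lifts f
    (a₀ := (R, R)) (e₀ := Complex.log (f (R, R))) (Complex.exp_log (hf0 _)) hf0
  have hFp : ∀ p, Complex.exp (F p) = f p := fun p => congrFun hF p
  set θ : ℝ × ℝ → ℝ := fun p => (F p).im with hθ
  have hθc : Continuous θ := by fun_prop
  have hXθ : ∀ p, X p = Real.exp (F p).re * Real.cos (θ p) := by
    intro p
    rw [← Complex.exp_re, hFp]; rfl
  have hYθ : ∀ p, Y p = Real.exp (F p).re * Real.sin (θ p) := by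
    intro p
    rw [← Complex.exp_im, hFp]; rfl
  have c1 : ∀ p : ℝ × ℝ, R ≤ p.1 → 0 < Real.cos (θ p) := fun p hp =>
    pos_of_mul_pos_right (hXθ p ▸ h1 p hp) (Real.exp_pos _).le
  have c2 : ∀ p : ℝ × ℝ, p.1 ≤ -R → Real.cos (θ p) < 0 := fun p hp => by
    have := hXθ p ▸ h2 p hp
    by_contra h
    push Not at h
    nlinarith [mul_nonneg (Real.exp_pos (F p).re).le h]
  have c3 : ∀ p : ℝ × ℝ, R ≤ p.2 → 0 < Real.sin (θ p) := fun p hp =>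
    pos_of_mul_pos_right (hYθ p ▸ h3 p hp) (Real.exp_pos _).le
  have c4 : ∀ p : ℝ × ℝ, p.2 ≤ -R → Real.sin (θ p) < 0 := fun p hp => by
    have := hYθ p ▸ h4 p hp
    by_contra h
    push Not at h
    nlinarith [mul_nonneg (Real.exp_pos (F p).re).le h]
  have hπ := Real.pi_pos
  have s0 : Real.sin 0 = 0 := Real.sin_zero
  have s1 : Real.sin Real.pi = 0 := Real.sin_pi
  have s2 : Real.sin (2 * Real.pi) = 0 := Real.sin_two_pi
  have k0 : Real.cos (Real.pi / 2) = 0 := Real.cos_pi_div_two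
  have k1 : Real.cos (3 * Real.pi / 2) = 0 := by
    rw [show 3 * Real.pi / 2 = Real.pi / 2 + Real.pi by ring, Real.cos_add_pi, k0, neg_zero]
  have k2 : Real.cos (5 * Real.pi / 2) = 0 := by
    rw [show 5 * Real.pi / 2 = Real.pi / 2 + 2 * Real.pi by ring, Real.cos_add_two_pi, k0]
  -- start
  have a1 : 0 < θ (R, R) ∧ θ (R, R) < Real.pi / 2 := by
    have e : θ (R, R) = Complex.arg (f (R, R)) := by
      simp only [hθ]; rw [hF0, Complex.log_im]
    rw [e]
    have hre : 0 < (f (R, R)).re := h1 (R, R) le_rfl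
    have him : 0 < (f (R, R)).im := h3 (R, R) le_rfl
    refine ⟨?_, ?_⟩
    · rcases (Complex.arg_nonneg_iff.2 him.le).lt_or_eq with h | h
      · exact h
      · have := (Complex.arg_eq_zero_iff.1 h.symm).2
        linarith
    · exact (abs_lt.1 (Complex.abs_arg_lt_pi_div_two_iff.2 (Or.inl hre))).2
  -- top
  have a2 : 0 < θ (-R, R) ∧ θ (-R, R) < Real.pi := by
    refine seg_stay (fun s => θ (s, R)) (by fun_prop) 0 Real.pi R (-R) ?_ ?_
      ⟨a1.1, by linarith [a1.2]⟩
    · intro s _ h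
      have := c3 (s, R) le_rfl
      rw [h] at this; linarith
    · intro s _ h
      have := c3 (s, R) le_rfl
      rw [h] at this; linarith
  have a2' : Real.pi / 2 < θ (-R, R) := by
    by_contra h
    push Not at h
    have := Real.cos_nonneg_of_neg_pi_div_two_le_of_le (by linarith [a2.1]) h
    linarith [c2 (-R, R) le_rfl]
  -- left
  have a3 : Real.pi / 2 < θ (-R, -R) ∧ θ (-R, -R) < 3 * Real.pi / 2 := by
    refine seg_stay (fun s => θ (-R, s)) (by fun_prop) _ _ R (-R) ?_ ?_
      ⟨a2', by linarith [a2.2]⟩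
    · intro s _ h
      have := c2 (-R, s) le_rfl
      rw [h] at this; linarith
    · intro s _ h
      have := c2 (-R, s) le_rfl
      rw [h] at this; linarith
  have a3' : Real.pi < θ (-R, -R) := by
    by_contra h
    push Not at h
    have := Real.sin_nonneg_of_nonneg_of_le_pi (by linarith [a3.1]) h
    linarith [c4 (-R, -R) le_rfl]
  -- bottom
  have a4 : Real.pi < θ (R, -R) ∧ θ (R, -R) < 2 * Real.pi := by
    refine seg_stay (fun s => θ (s, -R)) (by fun_prop) _ _ (-R) R ?_ ?_
      ⟨a3', by linarith [a3.2]⟩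
    · intro s _ h
      have := c4 (s, -R) le_rfl
      rw [h] at this; linarith
    · intro s _ h
      have := c4 (s, -R) le_rfl
      rw [h] at this; linarith
  have a4' : 3 * Real.pi / 2 < θ (R, -R) := by
    by_contra h
    push Not at h
    have := Real.cos_nonpos_of_pi_div_two_le_of_le (x := θ (R, -R)) (by linarith [a4.1])
      (by linarith)
    linarith [c1 (R, -R) le_rfl]
  -- right
  have a5 : 3 * Real.pi / 2 < θ (R, R) ∧ θ (R, R) < 5 * Real.pi / 2 := by
    refine seg_stay (fun s => θ (R, s)) (by fun_prop) _ _ (-R) R ?_ ?_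
      ⟨a4', by linarith [a4.2]⟩
    · intro s _ h
      have := c1 (R, s) le_rfl
      rw [h] at this; linarith
    · intro s _ h
      have := c1 (R, s) le_rfl
      rw [h] at this; linarith
  linarith [a1.2, a5.1]

/-- Global flow on `[0,T]` for a bounded, globally Lipschitz vector field. -/
lemma flow_exists {E : Type*} [NormedAddCommGroup E] [NormedSpace ℝ E] [CompleteSpace E]
    (f : ℝ → E → E) (T : ℝ) (hT : 0 < T) (K L : NNReal)
    (hlip : ∀ t, LipschitzWith K (f t)) (hc : ∀ x, Continuous (fun t => f t x))
    (hb : ∀ t x, ‖f t x‖ ≤ L) :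
    ∃ z : E → ℝ → E, (∀ p, z p 0 = p) ∧
      (∀ p, ∀ t ∈ Icc (0:ℝ) T, HasDerivWithinAt (z p) (f t (z p t)) (Icc 0 T) t) ∧
      Continuous (fun p => z p T) := by
  have ex : ∀ p : E, ∃ α : ℝ → E, α 0 = p ∧
      ∀ t ∈ Icc (0:ℝ) T, HasDerivWithinAt α (f t (α t)) (Icc 0 T) t := by
    intro p
    have hPL : IsPicardLindelof f (tmin := 0) (tmax := T) ⟨0, le_rfl, hT.le⟩ p
        (L * ⟨T, hT.le⟩) 0 L K :=
      { lipschitzOnWith := fun t _ => (hlip t).lipschitzOnWith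
        continuousOn := fun x _ => (hc x).continuousOn
        norm_le := fun t _ x _ => hb t x
        mul_max_le := by
          simp only [sub_zero, sub_self, max_eq_left hT.le, NNReal.coe_zero]
          exact le_of_eq rfl }
    exact hPL.exists_eq_forall_mem_Icc_hasDerivWithinAt₀
  choose z hz0 hz using ex
  refine ⟨z, hz0, hz, ?_⟩
  have hd : ∀ p, ∀ t ∈ Ico (0:ℝ) T, HasDerivWithinAt (z p) (f t (z p t)) (Ici t) t := by
    intro p t ht
    exact (hz p t ⟨ht.1, ht.2.le⟩).mono_of_mem_nhdsWithin
      (mem_of_superset (Icc_mem_nhdsGE ht.2) (Icc_subset_Icc_left ht.1))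
  have hcont : ∀ p, ContinuousOn (z p) (Icc 0 T) := fun p t ht => (hz p t ht).continuousWithinAt
  have hlipT : LipschitzWith (Real.toNNReal (Real.exp (K * (T - 0)))) (fun p => z p T) := by
    refine LipschitzWith.of_dist_le_mul fun p q => ?_
    have := dist_le_of_trajectories_ODE (v := f) (K := K) (δ := dist p q) (hlip) (hcont p) (hd p)
      (hcont q) (hd q) (by rw [hz0, hz0]) T ⟨hT.le, le_rfl⟩
    rw [Real.coe_toNNReal _ (Real.exp_pos _).le, mul_comm]
    exact this
  exact hlipT.continuous

/-- Periodic extension. -/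
lemma periodic_ext {E : Type*} [NormedAddCommGroup E] [NormedSpace ℝ E] [CompleteSpace E]
    (f : ℝ → E → E) (T : ℝ) (hT : 0 < T) (hfc : Continuous (fun q : ℝ × E => f q.1 q.2))
    (hfp : ∀ t x, f (t + T) x = f t x) (z : ℝ → E) (h0 : z 0 = z T)
    (hz : ∀ t ∈ Icc (0:ℝ) T, HasDerivWithinAt z (f t (z t)) (Icc 0 T) t) :
    ∃ w : ℝ → E, (∀ t, w (t + T) = w t) ∧ ∀ t, HasDerivAt w (f t (w t)) t := by
  have : Fact (0 < T) := ⟨hT⟩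
  have hzc : ContinuousOn z (Icc 0 T) := fun t ht => (hz t ht).continuousWithinAt
  set w : ℝ → E := fun t => AddCircle.liftIco T 0 z (t : AddCircle T) with hw
  have hwc : Continuous w :=
    (AddCircle.liftIco_zero_continuous h0 hzc).comp (AddCircle.continuous_mk' T)
  have hwp : ∀ t, w (t + T) = w t := by intro t; simp [hw]
  have hwz : ∀ t ∈ Icc (0:ℝ) T, w t = z t := by
    intro t ht
    rcases ht.2.lt_or_eq with h | h
    · exact AddCircle.liftIco_zero_coe_apply ⟨ht.1, h⟩
    · have h1 := hwp 0
      have h2 : w 0 = z 0 := AddCircle.liftIco_zero_coe_apply ⟨le_rfl, hT⟩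
      rw [h, ← h0, ← h2, ← h1, zero_add]
  set G : ℝ → E := fun t => f t (w t) with hG
  have hGc : Continuous G := hfc.comp (continuous_id.prodMk hwc)
  have hGp : Function.Periodic G T := by intro t; simp only [hG, hwp, hfp]
  have hint : ∀ t ∈ Icc (0:ℝ) T, ∫ s in (0:ℝ)..t, G s = z t - z 0 := by
    intro t ht
    refine intervalIntegral.integral_eq_sub_of_hasDerivAt_of_le ht.1
      (hzc.mono (Icc_subset_Icc_right ht.2)) ?_ (hGc.intervalIntegrable _ _)
    intro s hs
    have hs' : s ∈ Icc (0:ℝ) T := ⟨hs.1.le, hs.2.le.trans ht.2⟩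
    have := (hz s hs').hasDerivAt (Icc_mem_nhds hs.1 (hs.2.trans_le ht.2))
    simpa only [hG, hwz s hs'] using this
  set W : ℝ → E := fun t => z 0 + ∫ s in (0:ℝ)..t, G s with hW
  have hWd : ∀ t, HasDerivAt W (G t) t := fun t =>
    (hGc.integral_hasStrictDerivAt 0 t).hasDerivAt.const_add _
  have hWp : Function.Periodic W T := by
    intro t
    simp only [hW]
    have h1 : ∫ s in t..t + T, G s = 0 := by
      rw [hGp.intervalIntegral_add_eq t 0, zero_add, hint T ⟨hT.le, le_rfl⟩, h0, sub_self]
    rw [← intervalIntegral.integral_add_adjacent_intervals (hGc.intervalIntegrable 0 t)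
      (hGc.intervalIntegrable t (t+T)), h1, add_zero]
  have hWw : W = w := by
    funext t
    obtain ⟨s, hs, e⟩ := Function.Periodic.exists_mem_Ico₀
      (f := fun t => (W t, w t)) (c := T) (by intro t; simp only [hWp t, hwp t]) hT t
    have e1 := congrArg Prod.fst e
    have e2 := congrArg Prod.snd e
    simp only at e1 e2
    rw [e1, e2, hwz s ⟨hs.1, hs.2.le⟩]
    simp only [hW]
    rw [hint s ⟨hs.1, hs.2.le⟩]; abel
  refine ⟨w, hwp, fun t => ?_⟩
  have := hWd t
  rwa [hWw] at this

/-- Truncated exponential. -/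
noncomputable def gtr (k v : ℝ) : ℝ := Real.exp (min v k)

lemma gtr_pos (k v : ℝ) : 0 < gtr k v := Real.exp_pos _

lemma gtr_le (k v : ℝ) : gtr k v ≤ Real.exp k := Real.exp_le_exp.2 (min_le_right _ _)

lemma gtr_cont (k : ℝ) : Continuous (gtr k) := by unfold gtr; fun_prop

lemma gtr_lip (k v w : ℝ) : |gtr k v - gtr k w| ≤ Real.exp k * |v - w| := by
  have key : ∀ x y : ℝ, x ≤ y → y ≤ k → Real.exp y - Real.exp x ≤ Real.exp k * (y - x) := by
    intro x y hxy hy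
    have h1 := Real.add_one_le_exp (x - y)
    have h2 : Real.exp x = Real.exp y * Real.exp (x - y) := by rw [← Real.exp_add]; ring_nf
    have h3 := Real.exp_le_exp.2 hy
    have h4 := Real.exp_pos y
    rw [h2]
    nlinarith [mul_le_mul_of_nonneg_left h1 h4.le, mul_le_mul_of_nonneg_right h3 (sub_nonneg.2 hxy)]
  have main : ∀ v w : ℝ, v ≤ w → |gtr k v - gtr k w| ≤ Real.exp k * |v - w| := by
    intro v w h
    have hm : min v k ≤ min w k := min_le_min_right _ h
    have h1 := key _ _ hm (min_le_right _ _)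
    have h2 : min w k - min v k ≤ w - v := by
      rcases le_total v k with h' | h'
      · rw [min_eq_left h']; linarith [min_le_left w k]
      · rw [min_eq_right h', min_eq_right (h'.trans h)]; linarith
    unfold gtr
    rw [abs_sub_comm, abs_sub_comm v w, abs_of_nonneg (sub_nonneg.2 (Real.exp_le_exp.2 hm)),
      abs_of_nonneg (sub_nonneg.2 h)]
    exact h1.trans (mul_le_mul_of_nonneg_left h2 (Real.exp_pos _).le)
  rcases le_total v w with h | h
  · exact main v w h
  · rw [abs_sub_comm, abs_sub_comm v w]; exact main w v h

lemma disp_neg (s₀ s₁ k m : ℝ) (hs : s₀ ≤ s₁) (α β u w : ℝ → ℝ) (hα : Continuous α)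
    (hβ : Continuous β) (hβ0 : ∀ t, 0 < β t) (hu : ContinuousOn u (Icc s₀ s₁))
    (hd : ∀ t ∈ Ioo s₀ s₁, HasDerivAt u (α t - β t * gtr k (w t)) t) (hmk : m ≤ k)
    (hw : ∀ t ∈ Ioo s₀ s₁, m ≤ w t)
    (hI : ∫ t in s₀..s₁, α t < Real.exp m * ∫ t in s₀..s₁, β t) : u s₁ < u s₀ := by
  have h := intervalIntegral.sub_le_integral_of_hasDeriv_right_of_le hs hu
    (fun t ht => (hd t ht).hasDerivWithinAt) (φ := fun t => α t - Real.exp m * β t)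
    ((by fun_prop : Continuous fun t => α t - Real.exp m * β t).integrableOn_Icc) (by
      intro t ht
      have h1 : Real.exp m ≤ gtr k (w t) := Real.exp_le_exp.2 (le_min (hw t ht) hmk)
      nlinarith [mul_le_mul_of_nonneg_left h1 (hβ0 t).le])
  rw [intervalIntegral.integral_sub (hα.intervalIntegrable _ _)
    ((hβ.const_mul _).intervalIntegrable _ _), intervalIntegral.integral_const_mul] at h
  linarith

lemma disp_pos (s₀ s₁ k m : ℝ) (hs : s₀ ≤ s₁) (α β u w : ℝ → ℝ) (hα : Continuous α)
    (hβ : Continuous β) (hβ0 : ∀ t, 0 < β t) (hu : ContinuousOn u (Icc s₀ s₁))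
    (hd : ∀ t ∈ Ioo s₀ s₁, HasDerivAt u (α t - β t * gtr k (w t)) t)
    (hw : ∀ t ∈ Ioo s₀ s₁, w t ≤ m)
    (hI : Real.exp m * ∫ t in s₀..s₁, β t < ∫ t in s₀..s₁, α t) : u s₀ < u s₁ := by
  have h := intervalIntegral.sub_le_integral_of_hasDeriv_right_of_le hs hu.neg
    (fun t ht => (hd t ht).neg.hasDerivWithinAt) (φ := fun t => Real.exp m * β t - α t)
    ((by fun_prop : Continuous fun t => Real.exp m * β t - α t).integrableOn_Icc) (by
      intro t ht
      have h1 : gtr k (w t) ≤ Real.exp m := Real.exp_le_exp.2 ((min_le_left _ _).trans (hw t ht))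
      nlinarith [mul_le_mul_of_nonneg_left h1 (hβ0 t).le])
  rw [intervalIntegral.integral_sub ((hβ.const_mul _).intervalIntegrable _ _)
    (hα.intervalIntegrable _ _), intervalIntegral.integral_const_mul] at h
  simp only [Pi.neg_apply] at h
  linarith

lemma growth_le (s₀ s₁ M : ℝ) (hs : s₀ ≤ s₁) (u u' : ℝ → ℝ)
    (hd : ∀ t, HasDerivAt u (u' t) t) (hM : ∀ t, u' t ≤ M) : u s₁ - u s₀ ≤ M * (s₁ - s₀) := by
  have h := intervalIntegral.sub_le_integral_of_hasDeriv_right_of_le hs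
    (fun t _ => (hd t).continuousAt.continuousWithinAt)
    (fun t _ => (hd t).hasDerivWithinAt) (φ := fun _ => M)
    (continuous_const.integrableOn_Icc) (fun t _ => hM t)
  simpa [mul_comm] using h

lemma per_bound (T : ℝ) (hT : 0 < T) (a : ℝ → ℝ) (ha : Continuous a)
    (hp : ∀ t, a (t + T) = a t) : ∃ M, ∀ t, |a t| ≤ M := by
  have hp' : Function.Periodic a T := hp
  obtain ⟨M, hM⟩ := (hp'.isBounded_of_continuous hT.ne' ha).exists_norm_le
  exact ⟨M, fun t => hM _ (mem_range_self t)⟩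

lemma per_pos (T : ℝ) (hT : 0 < T) (b : ℝ → ℝ)
    (hp : ∀ t, b (t + T) = b t) (hb : ∀ t ∈ Icc (0:ℝ) T, 0 < b t) : ∀ t, 0 < b t := by
  intro t
  have hp' : Function.Periodic b T := hp
  obtain ⟨s, hs, e⟩ := hp'.exists_mem_Ico₀ hT t
  rw [e]; exact hb s ⟨hs.1, hs.2.le⟩

lemma exp_log_bounds (A B : ℝ) (hA : 0 < A) (hB : 0 < B) :
    A < Real.exp (Real.log (A / B) + 1) * B ∧ Real.exp (Real.log (A / B) - 1) * B < A := by
  have h0 : Real.exp (Real.log (A / B)) * B = A := by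
    rw [Real.exp_log (div_pos hA hB)]; field_simp
  constructor
  · calc A = Real.exp (Real.log (A / B)) * B := h0.symm
      _ < _ := mul_lt_mul_of_pos_right (Real.exp_lt_exp.2 (by linarith)) hB
  · calc _ < Real.exp (Real.log (A / B)) * B :=
        mul_lt_mul_of_pos_right (Real.exp_lt_exp.2 (by linarith)) hB
      _ = A := h0

/-- The Volterra predator–prey system with continuous `T`-periodic
coefficients, `b, d > 0` on `[0,T]` and positive mean values of `a` and `c`, has at
least one positive `T`-periodic solution. -/
theorem volterra_periodic_exists (T : ℝ) (hT : 0 < T) (a b c d : ℝ → ℝ)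
    (hac : Continuous a) (hbc : Continuous b) (hcc : Continuous c) (hdc : Continuous d)
    (hap : ∀ t, a (t + T) = a t) (hbp : ∀ t, b (t + T) = b t)
    (hcp : ∀ t, c (t + T) = c t) (hdp : ∀ t, d (t + T) = d t)
    (hbpos : ∀ t ∈ Set.Icc (0 : ℝ) T, 0 < b t)
    (hdpos : ∀ t ∈ Set.Icc (0 : ℝ) T, 0 < d t)
    (habar : 0 < (1 / T) * ∫ t in (0 : ℝ)..T, a t)
    (hcbar : 0 < (1 / T) * ∫ t in (0 : ℝ)..T, c t) :
    ∃ x y : ℝ → ℝ,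
      (∀ t, 0 < x t) ∧ (∀ t, 0 < y t) ∧
      (∀ t, x (t + T) = x t) ∧ (∀ t, y (t + T) = y t) ∧
      (∀ t, HasDerivAt x (x t * (a t - b t * y t)) t) ∧
      (∀ t, HasDerivAt y (y t * (-(c t) + d t * x t)) t) := by
  have hb0 := per_pos T hT b hbp hbpos
  have hd0 := per_pos T hT d hdp hdpos
  have hA : 0 < ∫ t in (0:ℝ)..T, a t := pos_of_mul_pos_right habar (by positivity)
  have hC : 0 < ∫ t in (0:ℝ)..T, c t := pos_of_mul_pos_right hcbar (by positivity)
  have hB : 0 < ∫ t in (0:ℝ)..T, b t :=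
    intervalIntegral.intervalIntegral_pos_of_pos (hbc.intervalIntegrable _ _) hb0 hT
  have hD : 0 < ∫ t in (0:ℝ)..T, d t :=
    intervalIntegral.intervalIntegral_pos_of_pos (hdc.intervalIntegrable _ _) hd0 hT
  obtain ⟨Ma, hMa⟩ := per_bound T hT a hac hap
  obtain ⟨Mb, hMb⟩ := per_bound T hT b hbc hbp
  obtain ⟨Mc, hMc⟩ := per_bound T hT c hcc hcp
  obtain ⟨Md, hMd⟩ := per_bound T hT d hdc hdp
  have hMa0 := (abs_nonneg _).trans (hMa 0)
  have hMb0 := (abs_nonneg _).trans (hMb 0)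
  have hMc0 := (abs_nonneg _).trans (hMc 0)
  have hMd0 := (abs_nonneg _).trans (hMd 0)
  obtain ⟨M, hM0, ha, hb, hc, hd⟩ : ∃ M : ℝ, 0 ≤ M ∧ (∀ t, |a t| ≤ M) ∧ (∀ t, |b t| ≤ M) ∧
      (∀ t, |c t| ≤ M) ∧ (∀ t, |d t| ≤ M) :=
    ⟨Ma + Mb + Mc + Md, by positivity, fun t => (hMa t).trans (by linarith),
      fun t => (hMb t).trans (by linarith), fun t => (hMc t).trans (by linarith),
      fun t => (hMd t).trans (by linarith)⟩
  clear hMa hMb hMc hMd hMa0 hMb0 hMc0 hMd0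
  obtain ⟨lV1, lV2⟩ := exp_log_bounds _ _ hA hB
  obtain ⟨lU1, lU2⟩ := exp_log_bounds _ _ hC hD
  set mV := Real.log ((∫ t in (0:ℝ)..T, a t) / ∫ t in (0:ℝ)..T, b t) with hmV
  set mU := Real.log ((∫ t in (0:ℝ)..T, c t) / ∫ t in (0:ℝ)..T, d t) with hmU
  obtain ⟨k, hk⟩ : ∃ k, k = max mV mU + 1 + M * T := ⟨_, rfl⟩
  have hMT : 0 ≤ M * T := by positivity
  have hkV : mV + 1 + M * T ≤ k := by rw [hk]; linarith [le_max_left mV mU]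
  have hkU : mU + 1 + M * T ≤ k := by rw [hk]; linarith [le_max_right mV mU]
  -- the truncated vector field
  let f : ℝ → ℝ × ℝ → ℝ × ℝ := fun t p =>
    (a t - b t * gtr k p.2, -(c t) + d t * gtr k p.1)
  have hg := gtr_cont k
  have hfc : Continuous (fun q : ℝ × (ℝ × ℝ) => f q.1 q.2) := by
    simp only [f]; fun_prop
  have hE := Real.exp_pos k
  let K : NNReal := ⟨M * Real.exp k, by positivity⟩
  let L : NNReal := ⟨M + M * Real.exp k, by positivity⟩
  have hterm : ∀ β : ℝ → ℝ, (∀ t, |β t| ≤ M) → ∀ t v w,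
      |β t * gtr k v - β t * gtr k w| ≤ M * Real.exp k * |v - w| := by
    intro β hβ t v w
    rw [← mul_sub, abs_mul, mul_assoc]
    exact mul_le_mul (hβ t) (gtr_lip k v w) (abs_nonneg _) hM0
  have hterm2 : ∀ β : ℝ → ℝ, (∀ t, |β t| ≤ M) → ∀ t v,
      |β t * gtr k v| ≤ M * Real.exp k := by
    intro β hβ t v
    rw [abs_mul, abs_of_pos (gtr_pos k v)]
    exact mul_le_mul (hβ t) (gtr_le k v) (gtr_pos k v).le hM0
  have hlip : ∀ t, LipschitzWith K (f t) := by
    intro t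
    refine LipschitzWith.of_dist_le_mul fun p q => ?_
    have hK : (K : ℝ) = M * Real.exp k := rfl
    have hK0 : 0 ≤ M * Real.exp k := by positivity
    rw [hK, Prod.dist_eq, Prod.dist_eq]
    refine max_le ?_ ?_
    · have h1 := hterm b hb t p.2 q.2
      have h2 := mul_le_mul_of_nonneg_left (le_max_right (dist p.1 q.1) (dist p.2 q.2)) hK0
      refine le_trans ?_ h2
      refine le_trans (le_of_eq ?_) h1
      simp only [f, Real.dist_eq]
      rw [← abs_neg]; congr 1; ring
    · have h1 := hterm d hd t p.1 q.1
      have h2 := mul_le_mul_of_nonneg_left (le_max_left (dist p.1 q.1) (dist p.2 q.2)) hK0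
      refine le_trans ?_ h2
      refine le_trans (le_of_eq ?_) h1
      simp only [f, Real.dist_eq]
      congr 1; ring
  have hbd : ∀ t x, ‖f t x‖ ≤ L := by
    intro t x
    have hL : (L : ℝ) = M + M * Real.exp k := rfl
    rw [hL, Prod.norm_def]
    refine max_le ?_ ?_
    · exact (abs_sub _ _).trans (add_le_add (ha t) (hterm2 b hb t x.2))
    · refine (abs_add_le _ _).trans (add_le_add ?_ (hterm2 d hd t x.1))
      rw [abs_neg]; exact hc t
  obtain ⟨z, hz0, hz, hzT⟩ := flow_exists f T hT K L hlip
    (fun x => hfc.comp (continuous_id.prodMk continuous_const)) hbd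
  have hzc : ∀ p, ContinuousOn (z p) (Icc 0 T) := fun p t ht => (hz p t ht).continuousWithinAt
  have hzd : ∀ p, ∀ t ∈ Ioo 0 T, HasDerivAt (z p) (f t (z p t)) t := fun p t ht =>
    (hz p t ⟨ht.1.le, ht.2.le⟩).hasDerivAt (Icc_mem_nhds ht.1 ht.2)
  have hz1 : ∀ p, ∀ t ∈ Ioo 0 T, HasDerivAt (fun t => (z p t).1)
      (a t - b t * gtr k (z p t).2) t := fun p t ht => (hzd p t ht).fst
  have hz2 : ∀ p, ∀ t ∈ Ioo 0 T, HasDerivAt (fun t => -(z p t).2)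
      (c t - d t * gtr k (z p t).1) t := fun p t ht => by
    have h : HasDerivAt (fun t => (z p t).2) (-(c t) + d t * gtr k (z p t).1) t :=
      (hzd p t ht).snd
    have h2 := h.fun_neg
    rwa [show -(-(c t) + d t * gtr k (z p t).1) = c t - d t * gtr k (z p t).1 by ring] at h2
  have hc1 : ∀ p, ContinuousOn (fun t => (z p t).1) (Icc 0 T) := fun p => (hzc p).fst
  have hc2 : ∀ p, ContinuousOn (fun t => -(z p t).2) (Icc 0 T) := fun p => (hzc p).snd.neg
  have hnear : ∀ p, ∀ t ∈ Ioo 0 T, ‖z p t - p‖ ≤ L * T := by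
    intro p t ht
    have h := (convex_Icc (0:ℝ) T).norm_image_sub_le_of_norm_hasDerivWithin_le (hz p)
      (fun s _ => hbd s _) (left_mem_Icc.2 hT.le) ⟨ht.1.le, ht.2.le⟩
    rw [hz0, sub_zero, Real.norm_of_nonneg ht.1.le] at h
    exact h.trans (mul_le_mul_of_nonneg_left ht.2.le L.2)
  have hn1 : ∀ p, ∀ t ∈ Ioo 0 T, |(z p t).1 - p.1| ≤ L * T := fun p t ht =>
    (norm_fst_le (z p t - p)).trans (hnear p t ht)
  have hn2 : ∀ p, ∀ t ∈ Ioo 0 T, |(z p t).2 - p.2| ≤ L * T := fun p t ht =>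
    (norm_snd_le (z p t - p)).trans (hnear p t ht)
  have hLT : 0 ≤ (L : ℝ) * T := mul_nonneg L.2 hT.le
  have hV1 := le_abs_self mV
  have hV2 := neg_abs_le mV
  have hU1 := le_abs_self mU
  have hU2 := neg_abs_le mU
  have hV0 := abs_nonneg mV
  have hU0 := abs_nonneg mU
  obtain ⟨p, hp1, hp2⟩ := miranda (fun p => (z p T).2 - p.2) (fun p => p.1 - (z p T).1)
    (by fun_prop) (by fun_prop) (|mV| + |mU| + 1 + L * T)
    (by
      intro p hp
      have := disp_neg 0 T k (mU + 1) hT.le c d _ _ hcc hdc hd0 (hc2 p) (hz2 p) (by linarith)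
        (fun t ht => by linarith [(abs_le.1 (hn1 p t ht)).1]) lU1
      simp only [hz0] at this
      linarith)
    (by
      intro p hp
      have := disp_pos 0 T k (mU - 1) hT.le c d _ _ hcc hdc hd0 (hc2 p) (hz2 p)
        (fun t ht => by linarith [(abs_le.1 (hn1 p t ht)).2]) lU2
      simp only [hz0] at this
      linarith)
    (by
      intro p hp
      have := disp_neg 0 T k (mV + 1) hT.le a b _ _ hac hbc hb0 (hc1 p) (hz1 p) (by linarith)
        (fun t ht => by linarith [(abs_le.1 (hn2 p t ht)).1]) lV1
      simp only [hz0] at this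
      linarith)
    (by
      intro p hp
      have := disp_pos 0 T k (mV - 1) hT.le a b _ _ hac hbc hb0 (hc1 p) (hz1 p)
        (fun t ht => by linarith [(abs_le.1 (hn2 p t ht)).2]) lV2
      simp only [hz0] at this
      linarith)
  obtain ⟨w, hwp, hwd⟩ := periodic_ext f T hT hfc
    (fun t x => by simp only [f, hap, hbp, hcp, hdp]) (z p)
    (by rw [hz0]; exact Prod.ext (by linarith) (by linarith)) (hz p)
  -- a priori bounds
  have hU : ∀ t, HasDerivAt (fun t => (w t).1) (a t - b t * gtr k (w t).2) t :=
    fun t => (hwd t).fst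
  have hV : ∀ t, HasDerivAt (fun t => (w t).2) (-(c t) + d t * gtr k (w t).1) t :=
    fun t => (hwd t).snd
  have hV' : ∀ t, HasDerivAt (fun t => -(w t).2) (c t - d t * gtr k (w t).1) t := fun t => by
    convert! (hV t).neg using 1
    ring
  have shift : ∀ α : ℝ → ℝ, (∀ t, α (t + T) = α t) → ∀ s,
      ∫ t in s..s + T, α t = ∫ t in (0:ℝ)..T, α t := by
    intro α hα s
    have h : Function.Periodic α T := hα
    rw [h.intervalIntegral_add_eq s 0, zero_add]
  have exV : ∀ s, ∃ t ∈ Ioo s (s + T), (w t).2 < mV + 1 := by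
    intro s
    by_contra hno
    push Not at hno
    have := disp_neg s (s + T) k (mV + 1) (by linarith) a b (fun t => (w t).1) (fun t => (w t).2)
      hac hbc hb0
      (fun t _ => (hU t).continuousAt.continuousWithinAt) (fun t _ => hU t) (by linarith) hno
      (by rw [shift a hap, shift b hbp]; exact lV1)
    simp only [hwp] at this
    exact lt_irrefl _ this
  have exU : ∀ s, ∃ t ∈ Ioo s (s + T), (w t).1 < mU + 1 := by
    intro s
    by_contra hno
    push Not at hno
    have := disp_neg s (s + T) k (mU + 1) (by linarith) c d (fun t => -(w t).2) (fun t => (w t).1)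
      hcc hdc hd0
      (fun t _ => (hV' t).continuousAt.continuousWithinAt) (fun t _ => hV' t) (by linarith) hno
      (by rw [shift c hcp, shift d hdp]; exact lU1)
    simp only [hwp] at this
    exact lt_irrefl _ this
  have bV : ∀ s, (w s).2 ≤ k := by
    intro s
    obtain ⟨t, ht, hlt⟩ := exV s
    have h := growth_le s t M ht.1.le _ _ hV' (fun t => by
      linarith [(abs_le.1 (hc t)).2, mul_pos (hd0 t) (gtr_pos k (w t).1)])
    have h2 : M * (t - s) ≤ M * T := mul_le_mul_of_nonneg_left (by linarith [ht.2]) hM0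
    linarith
  have bU : ∀ s, (w s).1 ≤ k := by
    intro s
    obtain ⟨t, ht, hlt⟩ := exU (s - T)
    have hts : t ≤ s := by linarith [ht.2]
    have h := growth_le t s M hts _ _ hU (fun t => by
      linarith [(abs_le.1 (ha t)).2, mul_pos (hb0 t) (gtr_pos k (w t).2)])
    have h2 : M * (s - t) ≤ M * T := mul_le_mul_of_nonneg_left (by linarith [ht.1]) hM0
    linarith
  have gV : ∀ t, gtr k (w t).2 = Real.exp (w t).2 := fun t => by
    unfold gtr; rw [min_eq_left (bV t)]
  have gU : ∀ t, gtr k (w t).1 = Real.exp (w t).1 := fun t => by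
    unfold gtr; rw [min_eq_left (bU t)]
  refine ⟨fun t => Real.exp (w t).1, fun t => Real.exp (w t).2, fun t => Real.exp_pos _,
    fun t => Real.exp_pos _, fun t => by simp only [hwp], fun t => by simp only [hwp],
    fun t => ?_, fun t => ?_⟩
  · have h := (hU t).exp
    rwa [gV t] at h
  · have h := (hV t).exp
    rwa [gU t] at h
end
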